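/- arXiv:0711.3183 — 14 statements merged into one kernel-verified Lean document; each statement's English description precedes it below -/
import Mathlib

section
/- Let M be a nondeterministic finite automaton with n states over an alphabet Σ. If the language L(M) accepted by M contains at least one palindrome, then L(M) contains a palindrome of length at most 2n² − 1. -/
/-- `listPow x m` is the concatenation of `m` copies of the word `x`. -/
def listPow {α : Type*} (x : List α) (m : ℕ) : List α := (List.replicate m x).flatten

/-- A word is a `k`-power if it is the concatenation of `k` copies of a non-empty word. -/
def IsKPower {α : Type*} (k : ℕ) (w : List α) : Prop :=
  ∃ x : List α, x ≠ [] ∧ w = listPow x k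

/-- A word is a power if it is a `k`-power for some `k ≥ 2`. -/
def IsPower {α : Type*} (w : List α) : Prop := ∃ k : ℕ, 2 ≤ k ∧ IsKPower k w

/-- A non-empty word is primitive if it is not a power. -/
def IsPrimitive {α : Type*} (w : List α) : Prop := w ≠ [] ∧ ¬ IsPower w

/-- A word is bordered if it has the form `u ++ w ++ u` with `u` non-empty. -/
def Bordered {α : Type*} (x : List α) : Prop :=
  ∃ u w : List α, u ≠ [] ∧ x = u ++ w ++ u

/-- A language is slender if the number of words of each length is bounded by a constant. -/
def Slender {α : Type*} (L : Language α) : Prop :=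
  ∃ C : ℕ, ∀ r : ℕ, {w | w ∈ L ∧ w.length = r}.Finite ∧
    {w | w ∈ L ∧ w.length = r}.ncard < C

/-- There is a palindrome of half-length `k` leading from `x.1` to `x.2`. -/
def PalQ {α σ : Type*} (M : NFA α σ) (k : ℕ) (x : σ × σ) : Prop :=
  ∃ w : List α, w.reverse = w ∧ w.length / 2 = k ∧ x.2 ∈ M.evalFrom {x.1} w

theorem PalQ_succ {α σ : Type*} (M : NFA α σ) (k : ℕ) (x : σ × σ) (h : PalQ M (k + 1) x) :
    ∃ y, PalQ M k y ∧ ∀ j, PalQ M j y → PalQ M (j + 1) x := by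
  obtain ⟨w, hw, hk, hx⟩ := h
  have hp : w.Palindrome := List.Palindrome.of_reverse_eq hw
  cases hp with
  | nil => simp at hk
  | singleton a => simp at hk
  | @cons_concat a v hv =>
    simp only [NFA.evalFrom_cons, NFA.evalFrom_append, NFA.stepSet_singleton,
      NFA.evalFrom_nil] at hx
    rw [NFA.mem_stepSet] at hx
    obtain ⟨q, hq, hqx⟩ := hx
    rw [NFA.mem_evalFrom_iff_exists] at hq
    obtain ⟨p, hp, hpq⟩ := hq
    refine ⟨(p, q), ⟨v, hv.reverse_eq, ?_, hpq⟩, ?_⟩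
    · simp at hk; omega
    · rintro j ⟨u, hu, hj, hpu⟩
      refine ⟨a :: (u ++ [a]), by simp [hu], ?_, ?_⟩
      · simp; omega
      · simp only [NFA.evalFrom_cons, NFA.evalFrom_append, NFA.stepSet_singleton,
      NFA.evalFrom_nil]
        rw [NFA.mem_stepSet]
        exact ⟨q, NFA.mem_evalFrom_iff_exists.2 ⟨p, hp, hpu⟩, hqx⟩

theorem PalQ_attained {α σ : Type*} (M : NFA α σ) (k : ℕ) : ∀ x : σ × σ, PalQ M k x →
    (∀ j < k, ¬ PalQ M j x) → ∀ j ≤ k, ∃ y, PalQ M j y ∧ ∀ i < j, ¬ PalQ M i y := by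
  induction k with
  | zero =>
    intro x hx hmin j hj
    obtain rfl : j = 0 := by omega
    exact ⟨x, hx, hmin⟩
  | succ k ih =>
    intro x hx hmin j hj
    rcases Nat.lt_or_ge k j with h | h
    · obtain rfl : j = k + 1 := by omega
      exact ⟨x, hx, hmin⟩
    · obtain ⟨y, hy, hyx⟩ := PalQ_succ M k x hx
      exact ih y hy (fun i hi hiy => hmin (i + 1) (by omega) (hyx i hiy)) j h

/-- If an NFA with n states accepts at least one palindrome, then it accepts a
palindrome of length at most 2n² - 1. -/
theorem nfa_accepts_short_palindrome {α σ : Type*} [Fintype σ] (M : NFA α σ) (n : ℕ)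
    (hn : Fintype.card σ = n)
    (h : ∃ w ∈ M.accepts, w.reverse = w) :
    ∃ w ∈ M.accepts, w.reverse = w ∧ w.length ≤ 2 * n ^ 2 - 1 := by
  classical
  obtain ⟨w, hw, hrev⟩ := h
  obtain ⟨t, ht, hw⟩ := NFA.mem_accepts.1 hw
  obtain ⟨s, hs, hst⟩ := NFA.mem_evalFrom_iff_exists.1 hw
  have hex : ∃ k, PalQ M k (s, t) := ⟨_, w, hrev, rfl, hst⟩
  have hk := Nat.find_spec hex
  have hmin : ∀ j < Nat.find hex, ¬ PalQ M j (s, t) := fun j hj => Nat.find_min hex hj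
  generalize Nat.find hex = k at hk hmin
  have hall := PalQ_attained M k _ hk hmin
  haveI : Nonempty (σ × σ) := ⟨(s, t)⟩
  choose! f hf hfm using hall
  have hinj : Function.Injective (fun i : Fin (k + 1) => f i) := by
    intro i j hij
    simp only at hij
    have hi : (i : ℕ) ≤ k := by omega
    have hj : (j : ℕ) ≤ k := by omega
    apply Fin.ext
    rcases lt_trichotomy (i : ℕ) j with h | h | h
    · exact absurd (hij ▸ hf i hi) (hfm j hj i h)
    · exact h
    · exact absurd (hij ▸ hf j hj) (hfm i hi j h)
  have hcard := Fintype.card_le_of_injective _ hinj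
  rw [Fintype.card_fin, Fintype.card_prod, hn, ← sq] at hcard
  obtain ⟨u, hu, hlen, hut⟩ := hk
  exact ⟨u, NFA.mem_accepts.2 ⟨t, ht, NFA.mem_evalFrom_iff_exists.2 ⟨s, hs, hut⟩⟩, hu, by omega⟩
end

section
/- Let Σ be an alphabet with at least two symbols, containing distinct letters a and b, and let n ≥ 1. Let L_n = ({a}^{n−1}·Σ)*·{a}^{n−1} (i.e., the set of words of the form x₁⋯x_m·a^{n−1} where each x_i = a^{n−1}c for some letter c ∈ Σ). Then: (i) L_n is accepted by an NFA with n states; (ii) every word in L_n of length strictly less than 3n − 1 is a palindrome; and (iii) the word a^{n−1}·a·a^{n−1}·b·a^{n−1} belongs to L_n, has length 3n − 1, and is not a palindrome. -/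
open Computability

/-- Inductive description of the words of `L_(k+1)`. -/
inductive LnWord {α : Type*} (a : α) (k : ℕ) : List α → Prop
  | base : LnWord a k (List.replicate k a)
  | step (c : α) (w : List α) : LnWord a k w → LnWord a k (List.replicate k a ++ c :: w)

theorem lnWord_append_iff {α : Type*} (a : α) (k : ℕ) (c : α) (w : List α) :
    LnWord a k (List.replicate k a ++ c :: w) ↔ LnWord a k w := by
  refine ⟨fun h => ?_, LnWord.step c w⟩
  generalize hv : List.replicate k a ++ c :: w = v at h
  cases h with
  | base => simp at hv
  | step d u hu =>
    have := List.append_cancel_left hv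
    simp only [List.cons.injEq] at this
    rw [this.2]; exact hu

theorem lnWord_prefix {α : Type*} (a : α) (k : ℕ) (v : List α) (h : LnWord a k v) :
    ∃ u, v = List.replicate k a ++ u := by
  cases h with
  | base => exact ⟨[], by simp⟩
  | step c w _ => exact ⟨_, rfl⟩

theorem mem_Ln_iff {α : Type*} (a : α) (k : ℕ) (S : Language α)
    (hS : ∀ w : List α, w ∈ S ↔ ∃ c : α, w = [c]) (w : List α) :
    w ∈ (({List.replicate k a} : Language α) * S)∗ *
        ({List.replicate k a} : Language α) ↔ LnWord a k w := by
  constructor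
  · intro h
    obtain ⟨x, hx, y, hy, rfl⟩ := Language.mem_mul.1 h
    have hy : y = List.replicate k a := hy
    subst hy
    obtain ⟨Ls, rfl, hLs⟩ := Language.mem_kstar.1 hx
    clear h hx
    induction Ls with
    | nil => exact LnWord.base
    | cons z Ls ih =>
      obtain ⟨p, hp, q, hq, rfl⟩ := Language.mem_mul.1 (hLs z (by simp))
      obtain ⟨c, rfl⟩ := (hS q).1 hq
      have hp : p = List.replicate k a := hp
      subst hp
      have := LnWord.step (a := a) (k := k) c _ (ih (fun y hy => hLs y (by simp [hy])))
      simpa using this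
  · intro h
    induction h with
    | base =>
      exact Language.mem_mul.2 ⟨[], Language.nil_mem_kstar _, _, rfl, rfl⟩
    | step c w _ ih =>
      obtain ⟨x, hx, y, hy, rfl⟩ := Language.mem_mul.1 ih
      obtain ⟨Ls, rfl, hLs⟩ := Language.mem_kstar.1 hx
      refine Language.mem_mul.2 ⟨((List.replicate k a ++ [c]) :: Ls).flatten,
        Language.join_mem_kstar ?_, y, hy, by simp⟩
      intro z hz
      rcases List.mem_cons.1 hz with rfl | hz
      · exact Language.append_mem_mul rfl ((hS _).2 ⟨c, rfl⟩)
      · exact hLs z hz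

/-- The cyclic automaton with `k + 1` states. -/
def lnNFA {α : Type*} (a : α) (k : ℕ) : NFA α (Fin (k + 1)) where
  step i c := {j | (i.val < k ∧ c = a ∧ j.val = i.val + 1) ∨ (i.val = k ∧ j.val = 0)}
  start := {0}
  accept := {j | j.val = k}

theorem lnNFA_acceptsFrom {α : Type*} (a : α) (k : ℕ) (w : List α) :
    ∀ i : Fin (k + 1), w ∈ (lnNFA a k).acceptsFrom {i} ↔
      LnWord a k (List.replicate i.val a ++ w) := by
  induction w with
  | nil =>
    intro i
    rw [NFA.nil_mem_acceptsFrom]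
    simp only [Set.mem_singleton_iff, exists_eq_left, List.append_nil]
    change i.val = k ↔ _
    constructor
    · intro h; rw [h]; exact LnWord.base
    · intro h
      obtain ⟨u, hu⟩ := lnWord_prefix _ _ _ h
      have := congrArg List.length hu
      simp at this
      omega
  | cons c w ih =>
    intro i
    rw [NFA.cons_mem_acceptsFrom, NFA.stepSet_singleton]
    by_cases hi : i.val < k
    · by_cases hc : c = a
      · have : (lnNFA a k).step i c = {⟨i.val + 1, by omega⟩} := by
          ext j; simp only [lnNFA, Fin.ext_iff, Set.mem_setOf_eq, Set.mem_singleton_iff, Fin.val_zero]; grind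
        rw [this, ih, hc]
        simp [List.replicate_succ']
      · have : (lnNFA a k).step i c = ∅ := by
          ext j; simp [lnNFA]; grind
        rw [this]
        constructor
        · intro h
          rw [NFA.mem_acceptsFrom] at h
          obtain ⟨s, _, hs⟩ := h
          rw [NFA.mem_evalFrom_iff_exists] at hs
          simp at hs
        · intro h
          obtain ⟨u, hu⟩ := lnWord_prefix _ _ _ h
          have := congrArg (fun l => l[i.val]?) hu
          simp [List.getElem?_append, hi] at this
          exact absurd this hc
    · have hik : i.val = k := by omega
      have : (lnNFA a k).step i c = {0} := by
        ext j; simp only [lnNFA, Fin.ext_iff, Set.mem_setOf_eq, Set.mem_singleton_iff, Fin.val_zero]; grind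
      rw [this, ih, hik, lnWord_append_iff]
      simp

/-- The language L_n = ({a}^(n-1)·Σ)*·{a}^(n-1) is accepted by an n-state NFA, all its
words of length < 3n - 1 are palindromes, and a^(n-1)·a·a^(n-1)·b·a^(n-1) ∈ L_n is a
non-palindrome of length 3n - 1. -/
theorem nonpalindrome_lower_bound {α : Type*} (a b : α) (hab : a ≠ b) (n : ℕ)
    (hn : 1 ≤ n) (S L : Language α)
    (hS : ∀ w : List α, w ∈ S ↔ ∃ c : α, w = [c])
    (hL : L = (({List.replicate (n - 1) a} : Language α) * S)∗ *
        ({List.replicate (n - 1) a} : Language α)) :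
    (∃ (σ : Type) (_ : Fintype σ) (M : NFA α σ), Fintype.card σ = n ∧ M.accepts = L) ∧
    (∀ w ∈ L, w.length < 3 * n - 1 → w.reverse = w) ∧
    ((List.replicate (n - 1) a ++ [a] ++ List.replicate (n - 1) a ++ [b] ++
        List.replicate (n - 1) a) ∈ L ∧
      (List.replicate (n - 1) a ++ [a] ++ List.replicate (n - 1) a ++ [b] ++
        List.replicate (n - 1) a).length = 3 * n - 1 ∧
      (List.replicate (n - 1) a ++ [a] ++ List.replicate (n - 1) a ++ [b] ++
        List.replicate (n - 1) a).reverse ≠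
        List.replicate (n - 1) a ++ [a] ++ List.replicate (n - 1) a ++ [b] ++
        List.replicate (n - 1) a) := by
  obtain ⟨k, rfl⟩ : ∃ k, n = k + 1 := ⟨n - 1, by omega⟩
  simp only [Nat.add_sub_cancel] at hL ⊢
  have hmem : ∀ w, w ∈ L ↔ LnWord a k w := fun w => by rw [hL]; exact mem_Ln_iff a k S hS w
  refine ⟨⟨Fin (k + 1), inferInstance, lnNFA a k, by simp, ?_⟩, ?_, ?_, ?_, ?_⟩
  · apply Language.ext
    intro w
    rw [hmem, NFA.accepts_eq_acceptsFrom_start]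
    change w ∈ (lnNFA a k).acceptsFrom {0} ↔ _
    rw [lnNFA_acceptsFrom]
    simp
  · intro w hw hlen
    rw [hmem] at hw
    cases hw with
    | base => simp
    | step c w hw =>
      cases hw with
      | base => simp
      | step d w hw =>
        obtain ⟨u, rfl⟩ := lnWord_prefix _ _ _ hw
        simp at hlen
        omega
  · rw [hmem]
    have := LnWord.step (a := a) (k := k) a _ (LnWord.step b _ LnWord.base)
    simpa using this
  · simp; omega
  · intro h
    have := congrArg (fun l => l[k]?) h
    simp [List.getElem?_append] at this
    exact hab this.symm
end

section
/- Let M be a complete DFA over an alphabet Σ with at least two symbols, and suppose the language L(M) accepted by M is slender. Then M has a dead state that is reachable from the initial state: there exists a state q and a word u with δ*(q₀, u) = q such that for every word w, δ*(q, w) is not an accepting state. -/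
/-- A complete DFA over an alphabet with at least two symbols accepting a slender
language has a reachable dead state. -/
theorem dfa_slender_has_dead_state {α σ : Type*} [Fintype σ] (M : DFA α σ)
    (halpha : ∃ a b : α, a ≠ b)
    (hslender : Slender M.accepts) :
    ∃ (q : σ) (u : List α), M.evalFrom M.start u = q ∧
      ∀ w : List α, M.evalFrom q w ∉ M.accept := by
  classical
  by_contra hcon
  push Not at hcon
  obtain ⟨a, b, hab⟩ := halpha
  obtain ⟨C, hC⟩ := hslender
  have h1 : ∀ q : σ, ∃ w : List α, (∃ u, M.evalFrom M.start u = q) → M.evalFrom q w ∈ M.accept := by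
    intro q
    by_cases h : ∃ u, M.evalFrom M.start u = q
    · obtain ⟨u, hu⟩ := h
      obtain ⟨w, hw⟩ := hcon q u hu
      exact ⟨w, fun _ => hw⟩
    · exact ⟨[], fun h' => absurd h' h⟩
  choose w hw using h1
  let B := Finset.univ.sup (fun q => (w q).length)
  have hB : ∀ q, (w q).length ≤ B := fun q =>
    Finset.le_sup (f := fun q => (w q).length) (Finset.mem_univ q)
  let n := (B + 1) * C
  let T : Finset (List α) :=
    (Finset.range (B + 1)).biUnion (fun i => (hC (n + i)).1.toFinset)
  have hT : T.card ≤ (B + 1) * C := by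
    refine (Finset.card_biUnion_le_card_mul _ _ C ?_).trans (by simp)
    intro i _
    rw [← Set.ncard_eq_toFinset_card _ (hC (n + i)).1]
    exact (hC (n + i)).2.le
  let g : (Fin n → Bool) → List α := fun v => List.ofFn (fun i => if v i then a else b)
  have hg : ∀ v, (g v).length = n := fun v => by simp [g]
  let f : (Fin n → Bool) → List α := fun v => g v ++ w (M.evalFrom M.start (g v))
  have hf : Function.Injective f := by
    intro v v' h
    have h2 : g v = g v' := (List.append_inj h ((hg v).trans (hg v').symm)).1
    have h3 := List.ofFn_injective h2
    funext i
    have h4 := congrFun h3 i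
    revert h4
    cases v i <;> cases v' i <;> simp [hab, hab.symm]
  have hmem : ∀ v ∈ (Finset.univ : Finset (Fin n → Bool)), f v ∈ T := by
    intro v _
    simp only [T, Finset.mem_biUnion, Finset.mem_range, Set.Finite.mem_toFinset, Set.mem_setOf_eq]
    refine ⟨(w (M.evalFrom M.start (g v))).length, Nat.lt_succ_of_le (hB _), ?_, ?_⟩
    · rw [DFA.mem_accepts]
      change M.evalFrom M.start (g v ++ _) ∈ _
      rw [DFA.evalFrom_of_append]
      exact hw _ ⟨_, rfl⟩
    · simp [f, hg]
  have hcard := Finset.card_le_card_of_injOn f hmem hf.injOn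
  rw [Finset.card_univ, Fintype.card_fun, Fintype.card_bool, Fintype.card_fin] at hcard
  have h5 : n < 2 ^ n := Nat.lt_two_pow_self
  have h6 : n = (B + 1) * C := rfl
  omega
end

section
/- Let u, v, w be words with v non-empty and uw non-empty, and let f, g ≥ 1 be integers with f ≠ g. If u·v^f·w and u·v^g·w are both non-primitive, then u·v^m·w is non-primitive for every integer m ≥ 1. Furthermore, if u·v·w and u·v²·w are both k-powers for some integer k ≥ 2, then v is a k-power and u·v^m·w is a k-power for every integer m ≥ 1. -/
namespace Pump

variable {α : Type*}

theorem len_pow (a : FreeMonoid α) (n : ℕ) : (a ^ n).length = n * a.length := by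
  induction n with
  | zero => simp
  | succ n ih => rw [pow_succ, FreeMonoid.length_mul, ih]; ring

theorem len_pos {a : FreeMonoid α} (h : a ≠ 1) : 0 < a.length := by
  rcases Nat.eq_zero_or_pos a.length with h0 | h0
  · exact absurd (FreeMonoid.length_eq_zero.mp h0) h
  · exact h0

theorem ne_one_of_len {a : FreeMonoid α} (h : 0 < a.length) : a ≠ 1 := by
  rintro rfl; simp at h

theorem len_le_of_dvd {a b : FreeMonoid α} (h : a ∣ b) : a.length ≤ b.length := by
  obtain ⟨c, rfl⟩ := h; simp

/-- Two prefixes of the same word are comparable. -/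
theorem pre {a b c : FreeMonoid α} (ha : a ∣ c) (hb : b ∣ c) (h : a.length ≤ b.length) :
    a ∣ b := by
  obtain ⟨x, hx⟩ := ha
  obtain ⟨y, hy⟩ := hb
  have h1 : (a.toList : List α) <+: c.toList := ⟨x.toList, by rw [hx]; rfl⟩
  have h2 : (b.toList : List α) <+: c.toList := ⟨y.toList, by rw [hy]; rfl⟩
  obtain ⟨t, ht⟩ := List.prefix_of_prefix_length_le h1 h2 h
  exact ⟨FreeMonoid.ofList t, ht.symm⟩

theorem pre_eq {a b c : FreeMonoid α} (ha : a ∣ c) (hb : b ∣ c) (h : a.length = b.length) :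
    a = b := by
  obtain ⟨t, ht⟩ := pre ha hb h.le
  have : t = 1 := by
    have := congrArg FreeMonoid.length ht
    rw [FreeMonoid.length_mul] at this
    exact FreeMonoid.length_eq_zero.mp (by omega)
  rw [ht, this, mul_one]

/-- Suffix version of `pre`. -/
theorem suf {a b x y : FreeMonoid α} (h : x * a = y * b) (hl : a.length ≤ b.length) :
    ∃ e, b = e * a := by
  have hL := congrArg FreeMonoid.length h
  simp only [FreeMonoid.length_mul] at hL
  obtain ⟨e, he⟩ := pre (a := y) (b := x) (c := x * a) ⟨b, h⟩ ⟨a, rfl⟩ (by omega)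
  refine ⟨e, ?_⟩
  rw [he, mul_assoc] at h
  exact (mul_left_cancel h).symm

theorem comm_of_dvd_pow {v s : FreeMonoid α} {j : ℕ} (h : v * s ∣ s ^ j) : Commute v s := by
  have h1 : s * v ∣ s ^ (j + 1) := by
    rw [pow_succ']
    exact mul_dvd_mul_left s ((Dvd.intro _ rfl).trans h)
  have h2 : v * s ∣ s ^ (j + 1) := h.trans (pow_dvd_pow s (by omega))
  exact pre_eq h2 h1 (by simp [add_comm])

theorem dvd_pow_of_comm {x b : FreeMonoid α} (hb : b ≠ 1) (h : Commute x b) {n : ℕ}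
    (hn : x.length ≤ n) : x ∣ b ^ n := by
  have h1 : x ∣ b ^ n * x := ⟨b ^ n, (h.pow_right n).eq.symm⟩
  refine pre h1 ⟨x, rfl⟩ ?_
  rw [len_pow]
  have := len_pos hb
  nlinarith

theorem comm_trans {a b c : FreeMonoid α} (hb : b ≠ 1) (h1 : Commute a b) (h2 : Commute b c) :
    Commute a c := by
  have e1 := dvd_pow_of_comm hb (h1.mul_left h2.symm) le_rfl
  have e2 := dvd_pow_of_comm hb (h2.symm.mul_left h1) le_rfl
  have : (a * c).length = (c * a).length := by simp [add_comm]
  rw [this] at e1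
  exact pre_eq e1 e2 this

theorem comm_cancel {a b c : FreeMonoid α} (h1 : Commute a c) (h2 : Commute (a * b) c) :
    Commute b c := by
  have h : a * (b * c) = a * (c * b) := by
    rw [← mul_assoc, h2.eq, ← mul_assoc, ← h1.eq, mul_assoc]
  exact mul_left_cancel h

theorem pow_ne {a : FreeMonoid α} (h : a ≠ 1) {n : ℕ} (hn : 1 ≤ n) : a ^ n ≠ 1 := by
  apply ne_one_of_len
  rw [len_pow]
  exact Nat.mul_pos hn (len_pos h)

theorem comm_of_pow {a b : FreeMonoid α} {n : ℕ} (hn : 1 ≤ n) (h : Commute (a ^ n) b) :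
    Commute a b := by
  by_cases ha : a = 1
  · subst ha; exact Commute.one_left b
  · exact comm_trans (pow_ne ha hn) (Commute.self_pow a n) h

theorem key {v z r s : FreeMonoid α} {d i j : ℕ} (hv : v ≠ 1) (hd : 1 ≤ d) (hi : 2 ≤ i)
    (hj : 2 ≤ j) (h1 : v * z = r ^ i) (h2 : v ^ d * (v * z) = s ^ j) : Commute v z := by
  have hvl := len_pos hv
  have hrv : Commute v r → Commute v z := fun h => by
    have : Commute (v * z) v := by rw [h1]; exact (h.pow_right i).symm
    exact (comm_cancel (Commute.refl v) this).symm
  have hsd : s ∣ s ^ j := dvd_pow_self s (by omega)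
  have hvd : v ^ d ∣ s ^ j := ⟨_, h2.symm⟩
  rcases le_or_gt s.length (v ^ d).length with hle | hlt
  · obtain ⟨p, hp⟩ := pre hsd hvd hle
    have hc : Commute v s := by
      apply comm_of_dvd_pow (j := j)
      refine ⟨p * z, ?_⟩
      rw [← h2, ← mul_assoc, (Commute.pow_self v d).eq, hp]
      simp only [mul_assoc]
    have h3 : Commute (v ^ d * (v * z)) v := by rw [h2]; exact (hc.pow_right j).symm
    have h4 := comm_cancel (Commute.pow_self v d) h3
    exact (comm_cancel (Commute.refl v) h4).symm
  obtain ⟨t, ht⟩ := pre hvd hsd hlt.le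
  have htl : 0 < t.length := by
    have := congrArg FreeMonoid.length ht
    rw [FreeMonoid.length_mul] at this; omega
  have ht1 := ne_one_of_len htl
  obtain ⟨j', rfl⟩ : ∃ j', j = j' + 2 := ⟨j - 2, by omega⟩
  obtain ⟨i', rfl⟩ : ∃ i', i = i' + 2 := ⟨i - 2, by omega⟩
  -- r^i = σ^(j-1) t
  have hW : r ^ (i' + 2) = (t * v ^ d) ^ (j' + 1) * t := by
    rw [mul_pow_mul, ← ht]
    rw [h1, pow_succ' s (j' + 1)] at h2
    have h6 : v ^ d * r ^ (i' + 2) = v ^ d * (t * s ^ (j' + 1)) := by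
      rw [h2, ← mul_assoc, ← ht]
    exact mul_left_cancel h6
  have hr1 : r ≠ 1 := by
    rintro rfl
    rw [one_pow] at h1
    have := congrArg FreeMonoid.length h1
    rw [FreeMonoid.length_mul] at this
    simp at this; simp_all
  have hrl := len_pos hr1
  set σ := t * v ^ d with hσ
  have hσl : σ.length = t.length + d * v.length := by rw [hσ, FreeMonoid.length_mul, len_pow]
  have hWl : (i' + 2) * r.length = (j' + 1) * σ.length + t.length := by
    have := congrArg FreeMonoid.length hW
    simpa only [FreeMonoid.length_mul, len_pow] using this
  have hvW : v ∣ r ^ (i' + 2) := ⟨z, h1.symm⟩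
  rcases le_or_gt (r.length + σ.length) ((i' + 2) * r.length + v.length) with hbig | hsmall
  · -- Fine and Wilf on W * v
    have hWvl : (r ^ (i' + 2) * v).length = (i' + 2) * r.length + v.length := by
      rw [FreeMonoid.length_mul, len_pow]
    have htv : t * v ∣ σ := mul_dvd_mul_left t (dvd_pow_self v (by omega))
    have hWσ : r ^ (i' + 2) * v ∣ σ ^ (j' + 3) := by
      rw [hW, mul_assoc, pow_succ σ (j' + 2), pow_succ σ (j' + 1), mul_assoc]
      exact mul_dvd_mul_left _ (htv.trans (Dvd.intro _ rfl))
    have hWr : r ^ (i' + 2) * v ∣ r ^ ((i' + 2) + (i' + 2)) := by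
      rw [pow_add r (i' + 2) (i' + 2)]; exact mul_dvd_mul_left _ hvW
    have a1 : r * σ ∣ r ^ (i' + 2) * v := by
      refine pre (c := r ^ ((i' + 2) + (i' + 2))) ?_ hWr ?_
      · have : σ ∣ r ^ (i' + 2) := by
          rw [hW, pow_succ', mul_assoc]; exact Dvd.intro _ rfl
        have h5 := mul_dvd_mul_left r this
        rw [← pow_succ'] at h5
        exact h5.trans (pow_dvd_pow r (by omega))
      · rw [hWvl, FreeMonoid.length_mul]; exact hbig
    have a2 : σ * r ∣ r ^ (i' + 2) * v := by
      refine pre (c := σ ^ (j' + 4)) ?_ (hWσ.trans (pow_dvd_pow σ (by omega))) ?_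
      · rw [pow_succ' σ (j' + 3)]
        apply mul_dvd_mul_left
        exact ((dvd_pow_self r (by omega)).trans (Dvd.intro _ rfl)).trans hWσ
      · rw [hWvl, FreeMonoid.length_mul]; omega
    have hrσ : Commute r σ := pre_eq a1 a2 (by simp [add_comm])
    have htσ : Commute t σ := by
      have : Commute (σ ^ (j' + 1) * t) σ := by rw [← hW]; exact hrσ.pow_left _
      exact comm_cancel (Commute.pow_self σ _) this
    have hvσ : Commute (v ^ d) σ := comm_cancel htσ (by rw [← hσ])
    have hσ1 : σ ≠ 1 := ne_one_of_len (by omega)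
    exact hrv (comm_of_pow hd (comm_trans hσ1 hvσ hrσ.symm))
  · have hj0 : j' = 0 := by
      by_contra hne
      have : 1 ≤ j' := by omega
      nlinarith [Nat.mul_le_mul_right σ.length this, Nat.zero_le (i' * r.length)]
    subst hj0
    have htr : t.length + v.length < r.length := by nlinarith
    have hW' : r ^ (i' + 2) = t * v ^ d * t := by rw [hW]; simp [hσ]
    obtain ⟨y, hy⟩ : t ∣ r := pre (c := r ^ (i' + 2))
      ⟨v ^ d * t, by rw [hW', mul_assoc]⟩ (dvd_pow_self r (by omega)) (by omega)
    obtain ⟨y', hy'⟩ : ∃ e, r = e * t :=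
      suf (x := t * v ^ d) (y := r ^ (i' + 1)) (by rw [← hW', pow_succ]) (by omega)
    have hyl : t.length + y.length = r.length := by
      rw [hy, FreeMonoid.length_mul]
    have hyl' : y'.length + t.length = r.length := by
      conv_rhs => rw [hy']
      rw [FreeMonoid.length_mul]
    have hq : v ^ d = y * (r ^ i' * y') := by
      have : t * (v ^ d * t) = t * (y * (r ^ i' * y') * t) := by
        rw [← mul_assoc, ← hW', pow_succ, pow_succ']
        calc r * r ^ i' * r = (t * y) * r ^ i' * (y' * t) := by rw [← hy, ← hy']
          _ = _ := by simp only [mul_assoc]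
      exact mul_right_cancel (mul_left_cancel this)
    have hy'r : y' ∣ r := ⟨t, hy'⟩
    have hy'q : y' ∣ r ^ i' * y' := by
      rcases Nat.eq_zero_or_pos i' with h0 | h0
      · subst h0; simp
      · exact (hy'r.trans (dvd_pow_self r (by omega))).trans (Dvd.intro _ rfl)
    have hvy' : v ∣ y' := pre hvW (hy'r.trans (dvd_pow_self r (by omega))) (by omega)
    have hyv : Commute y v := by
      apply comm_of_dvd_pow (j := d)
      rw [hq]
      exact mul_dvd_mul_left _ (hvy'.trans hy'q)
    have hqv : Commute (r ^ i' * y') v :=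
      comm_cancel hyv (by rw [← hq]; exact Commute.pow_self v d)
    have hyq : Commute y (r ^ i' * y') := comm_trans hv hyv hqv.symm
    have hyy : y = y' := by
      refine pre_eq (c := y * (r ^ i' * y')) (Dvd.intro _ rfl) ?_ (by omega)
      rw [hyq.eq]; exact hy'q.trans (Dvd.intro _ rfl)
    subst hyy
    have hty : Commute t y := hy.symm.trans hy'
    have hy1 : y ≠ 1 := ne_one_of_len (by omega)
    have htv : Commute t v := comm_trans hy1 hty hyv
    apply hrv
    rw [hy]
    exact (htv.mul_left hyv).symm

theorem root_aux (n : ℕ) : ∀ a b : FreeMonoid α, a.length + b.length ≤ n → Commute a b →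
    ∃ (p : FreeMonoid α) (k l : ℕ), a = p ^ k ∧ b = p ^ l := by
  induction n with
  | zero =>
    intro a b h _
    refine ⟨1, 0, 0, ?_, ?_⟩ <;> rw [pow_zero] <;> exact FreeMonoid.length_eq_zero.mp (by omega)
  | succ n ih =>
    have main : ∀ a b : FreeMonoid α, a.length + b.length ≤ n + 1 → Commute a b →
        a.length ≤ b.length → ∃ (p : FreeMonoid α) (k l : ℕ), a = p ^ k ∧ b = p ^ l := by
      intro a b h hc hle
      by_cases ha : a = 1
      · exact ⟨b, 0, 1, by simp [ha], by simp⟩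
      have hal := len_pos ha
      obtain ⟨e, he⟩ := pre (c := a * b) ⟨b, rfl⟩ ⟨a, hc.eq⟩ hle
      subst he
      have hce : Commute e a := comm_cancel (Commute.refl a) hc.symm
      rw [FreeMonoid.length_mul] at h
      obtain ⟨p, k, l, h1, h2⟩ := ih a e (by omega) hce.symm
      exact ⟨p, k, k + l, h1, by rw [pow_add, ← h1, ← h2]⟩
    intro a b h hc
    rcases le_total a.length b.length with hle | hle
    · exact main a b h hc hle
    · obtain ⟨p, k, l, h1, h2⟩ := main b a (by omega) hc.symm hle
      exact ⟨p, l, k, h2, h1⟩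

theorem conj_pow (A : List α) : ∀ (B x : FreeMonoid α) (k : ℕ), 1 ≤ k → x ≠ 1 →
    FreeMonoid.ofList A * B = x ^ k →
    ∃ y : FreeMonoid α, y ≠ 1 ∧ B * FreeMonoid.ofList A = y ^ k := by
  induction A with
  | nil => intro B x k _ hx h; exact ⟨x, hx, by simpa using h⟩
  | cons c A ih =>
    intro B x k hk hx h
    rw [FreeMonoid.ofList_cons] at h ⊢
    have hxl := len_pos hx
    obtain ⟨e, he⟩ := pre (a := FreeMonoid.of c) (b := x) (c := x ^ k)
      ⟨FreeMonoid.ofList A * B, by rw [← h, mul_assoc]⟩ (dvd_pow_self x (by omega))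
      (by rw [FreeMonoid.length_of]; exact hxl)
    have h3 : FreeMonoid.ofList A * (B * FreeMonoid.of c) = (e * FreeMonoid.of c) ^ k := by
      have : FreeMonoid.of c * (FreeMonoid.ofList A * (B * FreeMonoid.of c)) =
          FreeMonoid.of c * (e * FreeMonoid.of c) ^ k := by
        rw [← mul_pow_mul, ← he, ← h]; simp only [mul_assoc]
      exact mul_left_cancel this
    obtain ⟨y, hy, h4⟩ := ih _ _ k hk (ne_one_of_len (by simp)) h3
    exact ⟨y, hy, by rw [← h4, mul_assoc]⟩

theorem listPow_eq (x : List α) (m : ℕ) :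
    FreeMonoid.ofList (listPow x m) = FreeMonoid.ofList x ^ m := by
  induction m with
  | zero => simp [listPow]
  | succ m ih =>
    rw [pow_succ', ← ih, ← FreeMonoid.ofList_append]
    simp [listPow, List.replicate_succ]

theorem isKPower_iff (k : ℕ) (w : List α) :
    IsKPower k w ↔ ∃ x : FreeMonoid α, x ≠ 1 ∧ FreeMonoid.ofList w = x ^ k := by
  constructor
  · rintro ⟨x, hx, rfl⟩
    exact ⟨FreeMonoid.ofList x, hx, listPow_eq x k⟩
  · rintro ⟨x, hx, h⟩
    refine ⟨x.toList, hx, ?_⟩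
    apply FreeMonoid.ofList.injective
    rw [h, listPow_eq, FreeMonoid.ofList_toList]

/-- Rotation: `u v w` is a `k`-power iff `v w u` is. -/
theorem rot (u v w : List α) (k : ℕ) (hk : 1 ≤ k) :
    IsKPower k (u ++ v ++ w) ↔ ∃ x : FreeMonoid α, x ≠ 1 ∧
      FreeMonoid.ofList v * FreeMonoid.ofList (w ++ u) = x ^ k := by
  rw [isKPower_iff]
  constructor
  · rintro ⟨x, hx, h⟩
    obtain ⟨y, hy, h'⟩ := conj_pow u (FreeMonoid.ofList (v ++ w)) x k hk hx
      (by rw [← h, ← FreeMonoid.ofList_append, List.append_assoc])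
    exact ⟨y, hy, by rw [← h']; simp only [FreeMonoid.ofList_append, mul_assoc]⟩
  · rintro ⟨x, hx, h⟩
    obtain ⟨y, hy, h'⟩ := conj_pow (v ++ w) (FreeMonoid.ofList u) x k hk hx
      (by rw [← h]; simp only [FreeMonoid.ofList_append, mul_assoc])
    exact ⟨y, hy, by rw [← h']; simp only [FreeMonoid.ofList_append, mul_assoc]⟩

theorem key' {v z r s : FreeMonoid α} {f g i j : ℕ} (hv : v ≠ 1) (hf : 1 ≤ f) (hfg : f < g)
    (hi : 2 ≤ i) (hj : 2 ≤ j) (h1 : v ^ f * z = r ^ i) (h2 : v ^ g * z = s ^ j) :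
    Commute v z := by
  obtain ⟨f, rfl⟩ : ∃ f', f = f' + 1 := ⟨f - 1, by omega⟩
  obtain ⟨d, rfl⟩ : ∃ d, g = d + (f + 1) := ⟨g - (f + 1), by omega⟩
  have := key (v := v) (z := v ^ f * z) (d := d) hv (by omega) hi hj
    (by rw [← h1, pow_succ', mul_assoc]) (by rw [← h2, pow_add, pow_succ' v f]; simp only [mul_assoc])
  exact (comm_cancel (Commute.pow_self v f) this.symm).symm

theorem not_prim {w : List α} (hw : w ≠ []) (h : ¬ IsPrimitive w) :
    ∃ k, 2 ≤ k ∧ IsKPower k w := by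
  by_contra hc
  exact h ⟨hw, hc⟩

end Pump

/-- If u·v^f·w and u·v^g·w (f ≠ g, f,g ≥ 1) are non-primitive, then u·v^m·w is
non-primitive for all m ≥ 1; moreover, if u·v·w and u·v²·w are k-powers, then v and
u·v^m·w are k-powers for all m ≥ 1. -/
theorem nonprimitive_pumping {α : Type*} (u v w : List α) (hv : v ≠ [])
    (huw : u ++ w ≠ []) (f g : ℕ) (hf : 1 ≤ f) (hg : 1 ≤ g) (hfg : f ≠ g) :
    ((¬ IsPrimitive (u ++ listPow v f ++ w) ∧ ¬ IsPrimitive (u ++ listPow v g ++ w)) →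
      ∀ m : ℕ, 1 ≤ m → ¬ IsPrimitive (u ++ listPow v m ++ w)) ∧
    (∀ k : ℕ, 2 ≤ k → IsKPower k (u ++ v ++ w) → IsKPower k (u ++ listPow v 2 ++ w) →
      IsKPower k v ∧ ∀ m : ℕ, 1 ≤ m → IsKPower k (u ++ listPow v m ++ w)) := by
  have hv1 : FreeMonoid.ofList v ≠ 1 := hv
  have hz1 : FreeMonoid.ofList (w ++ u) ≠ 1 := by
    intro h
    have h' : w ++ u = [] := h
    apply huw
    simp only [List.append_eq_nil_iff] at h' ⊢
    exact ⟨h'.2, h'.1⟩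
  have hne : ∀ m : ℕ, u ++ listPow v m ++ w ≠ [] := by
    intro m h
    apply huw
    simp only [List.append_eq_nil_iff] at h ⊢
    exact ⟨h.1.1, h.2⟩
  constructor
  · rintro ⟨hF, hG⟩ m hm hP
    obtain ⟨i, hi, hF⟩ := Pump.not_prim (hne f) hF
    obtain ⟨j, hj, hG⟩ := Pump.not_prim (hne g) hG
    rw [Pump.rot _ _ _ _ (by omega), Pump.listPow_eq] at hF hG
    obtain ⟨r, -, hr⟩ := hF
    obtain ⟨s, -, hs⟩ := hG
    have hc : Commute (FreeMonoid.ofList v) (FreeMonoid.ofList (w ++ u)) := by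
      rcases lt_or_gt_of_ne hfg with h | h
      · exact Pump.key' hv1 hf h hi hj hr hs
      · exact Pump.key' hv1 hg h hj hi hs hr
    obtain ⟨p, a, b, ha, hb⟩ := Pump.root_aux _ _ _ le_rfl hc
    have ha0 : a ≠ 0 := by rintro rfl; exact hv1 (by rw [ha, pow_zero])
    have hb0 : b ≠ 0 := by rintro rfl; exact hz1 (by rw [hb, pow_zero])
    have hp : p ≠ 1 := by rintro rfl; exact hv1 (by rw [ha, one_pow])
    have ham : 1 ≤ a * m := Nat.mul_pos (by omega) hm
    refine hP.2 ⟨a * m + b, by omega, ?_⟩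
    rw [Pump.rot _ _ _ _ (by omega), Pump.listPow_eq]
    exact ⟨p, hp, by rw [ha, hb, pow_add, pow_mul]⟩
  · intro k hk h1 h2
    rw [Pump.rot _ _ _ _ (by omega)] at h1 h2
    rw [Pump.listPow_eq] at h2
    obtain ⟨x, hx, h1⟩ := h1
    obtain ⟨y, hy, h2⟩ := h2
    have hc : Commute (FreeMonoid.ofList v) (FreeMonoid.ofList (w ++ u)) :=
      Pump.key' (f := 1) (g := 2) hv1 le_rfl (by omega) hk hk (by rw [pow_one]; exact h1) h2
    have hvx : Commute x (FreeMonoid.ofList v) := by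
      apply Pump.comm_of_pow (n := k) (by omega)
      rw [← h1]; exact (Commute.refl _).mul_left hc.symm
    have hxy : y ^ k = x ^ k * FreeMonoid.ofList v := by
      rw [← h2, ← h1, pow_two, mul_assoc, mul_assoc, hc.eq]
    have hvy : Commute y (FreeMonoid.ofList v) := by
      apply Pump.comm_of_pow (n := k) (by omega)
      rw [hxy]; exact (hvx.pow_left k).mul_left (Commute.refl _)
    have hcxy : Commute x y := Pump.comm_trans hv1 hvx hvy.symm
    have hlen : x.length ≤ y.length := by
      have := congrArg FreeMonoid.length hxy
      rw [FreeMonoid.length_mul, Pump.len_pow, Pump.len_pow] at this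
      have h7 : k * x.length ≤ k * y.length := by omega
      exact Nat.le_of_mul_le_mul_left h7 (by omega)
    obtain ⟨e, he⟩ := Pump.pre (c := x * y) ⟨y, rfl⟩ ⟨x, hcxy.eq⟩ hlen
    have hxe : Commute e x := Pump.comm_cancel (Commute.refl x) (by rw [← he]; exact hcxy.symm)
    have hve : FreeMonoid.ofList v = e ^ k := by
      rw [he, hxe.symm.mul_pow] at hxy
      exact (mul_left_cancel hxy).symm
    have he1 : e ≠ 1 := by rintro rfl; exact hv1 (by rw [hve, one_pow])
    refine ⟨(Pump.isKPower_iff k v).mpr ⟨e, he1, hve⟩, ?_⟩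
    intro m hm
    rw [Pump.rot _ _ _ _ (by omega), Pump.listPow_eq]
    obtain ⟨n, rfl⟩ : ∃ n, m = n + 1 := ⟨m - 1, by omega⟩
    refine ⟨e ^ n * x, ?_, ?_⟩
    · apply Pump.ne_one_of_len
      have := Pump.len_pos hx
      rw [FreeMonoid.length_mul]; omega
    · rw [pow_succ, mul_assoc, h1, (hxe.pow_left n).mul_pow, hve, ← pow_mul, ← pow_mul,
        mul_comm k n]
end

section
/- Let M be a complete DFA with n states, let k ≥ 2 be an integer, and let ℓ ≥ 0 be an integer such that every word in L(M) of length at least ℓ is a k-power. Then for every integer r ≥ ℓ, the number of words of length r in L(M) is at most n. -/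
theorem listPow_succ' {α : Type*} (x : List α) (m : ℕ) :
    listPow x (m + 1) = x ++ listPow x m := by
  simp [listPow, List.replicate_succ]

theorem length_listPow' {α : Type*} (x : List α) (m : ℕ) :
    (listPow x m).length = m * x.length := by
  simp [listPow]

/-- If every word of length ≥ ℓ accepted by an n-state DFA is a k-power, then for every
r ≥ ℓ the DFA accepts at most n words of length r. -/
theorem dfa_kpower_slender {α σ : Type*} [Fintype σ] (M : DFA α σ) (n : ℕ)
    (hn : Fintype.card σ = n) (k : ℕ) (hk : 2 ≤ k) (ℓ : ℕ)
    (h : ∀ w ∈ M.accepts, ℓ ≤ w.length → IsKPower k w) :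
    ∀ r : ℕ, ℓ ≤ r →
      {w | w ∈ M.accepts ∧ w.length = r}.Finite ∧
      {w | w ∈ M.accepts ∧ w.length = r}.ncard ≤ n := by
  intro r hr
  obtain ⟨m, rfl⟩ : ∃ m, k = m + 2 := ⟨k - 2, by omega⟩
  have hinj : Set.InjOn (fun w : List α => M.eval (w.take (r / (m + 2))))
      {w | w ∈ M.accepts ∧ w.length = r} := by
    rintro w ⟨hw, hwr⟩ w' ⟨hw', hwr'⟩ heq
    have len : ∀ z : List α, (listPow z (m + 2)).length = r → r / (m + 2) = z.length := by
      intro z hz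
      rw [length_listPow'] at hz
      rw [← hz]
      exact Nat.mul_div_cancel_left _ (by omega)
    obtain ⟨x, -, rfl⟩ := h w hw (by omega)
    obtain ⟨y, -, rfl⟩ := h w' hw' (by omega)
    have hx := len x hwr
    have hy := len y hwr'
    have hxy : x.length = y.length := by omega
    have e : M.eval x = M.eval y := by
      have := heq
      simp only [listPow_succ' _ (m + 1)] at this
      rwa [List.take_left' hx.symm, List.take_left' hy.symm] at this
    have hacc : x ++ listPow y (m + 1) ∈ M.accepts := by
      rw [listPow_succ' y (m + 1)] at hw'
      rw [DFA.mem_accepts, DFA.eval, DFA.evalFrom_of_append] at hw' ⊢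
      unfold DFA.eval at e
      rwa [e]
    have hl : (x ++ listPow y (m + 1)).length = r := by
      rw [← hwr', listPow_succ' y (m + 1), List.length_append, List.length_append, hxy]
    obtain ⟨z, -, hz⟩ := h _ hacc (by omega)
    have hzl := len z (by rw [← hz]; exact hl)
    rw [listPow_succ' z (m + 1)] at hz
    obtain ⟨h1, h2⟩ := List.append_inj hz (by omega)
    rw [listPow_succ', listPow_succ'] at h2
    obtain ⟨h3, -⟩ := List.append_inj h2 (by omega)
    rw [h1, h3]
  have hfin := Set.Finite.of_finite_image (Set.toFinite _) hinj
  refine ⟨hfin, ?_⟩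
  rw [← Set.ncard_image_of_injOn hinj, ← hn, ← Nat.card_eq_fintype_card]
  exact Set.ncard_le_card _
end

section
/- Let L ⊆ Σ* be a regular language and let k ≥ 2 be an integer. Every word in L is a k-power if and only if L can be written as a finite union of languages of the form u·v*·w (with u, v, w ∈ Σ*) such that for each such triple there exist a primitive word x ∈ Σ* and integers i ≥ 0 and j ≥ 1 with v = x^{ik} and w·u = x^{jk}. -/
namespace KPow

variable {α : Type*}

lemma lp_zero (x : List α) : listPow x 0 = [] := by simp [listPow]

lemma lp_succ (x : List α) (n : ℕ) : listPow x (n + 1) = x ++ listPow x n := by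
  simp [listPow, List.replicate_succ]

lemma lp_one (x : List α) : listPow x 1 = x := by simp [listPow]

lemma lp_add (x : List α) (m n : ℕ) : listPow x (m + n) = listPow x m ++ listPow x n := by
  rw [listPow, List.replicate_add, List.flatten_append]; rfl

lemma lp_succ' (x : List α) (n : ℕ) : listPow x (n + 1) = listPow x n ++ x := by
  rw [lp_add, lp_one]

lemma lp_mul (x : List α) (m n : ℕ) : listPow x (m * n) = listPow (listPow x m) n := by
  induction n with
  | zero => simp [lp_zero]
  | succ n ih => rw [Nat.mul_succ, lp_add, ih, lp_succ']

lemma lp_nil (n : ℕ) : listPow ([] : List α) n = [] := by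
  induction n with
  | zero => simp [lp_zero]
  | succ n ih => rw [lp_succ, ih]; rfl

lemma lp_length (x : List α) (n : ℕ) : (listPow x n).length = n * x.length := by
  simp [listPow]

lemma length_pos {x : List α} (h : x ≠ []) : 1 ≤ x.length := List.length_pos_iff.mpr h

/-- Two periods on a long word commute. -/
lemma fw {s s1 s2 q y : List α} (h1 : s = s1 ++ y) (h1' : s1 <:+ s) (h2 : s = s2 ++ q)
    (h2' : s2 <:+ s) (hl : q.length + y.length ≤ s.length) : q ++ y = y ++ q := by
  have l1 : s.length = s1.length + y.length := by rw [h1]; simp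
  have l2 : s.length = s2.length + q.length := by rw [h2]; simp
  have hq : q <:+ s := ⟨s2, h2.symm⟩
  have hy : y <:+ s := ⟨s1, h1.symm⟩
  have a : q <:+ s1 := List.suffix_of_suffix_length_le hq h1' (by omega)
  have b : y <:+ s2 := List.suffix_of_suffix_length_le hy h2' (by omega)
  have a' : q ++ y <:+ s := by
    obtain ⟨t, ht⟩ := a
    exact ⟨t, by rw [h1, ← ht]; simp⟩
  have b' : y ++ q <:+ s := by
    obtain ⟨t, ht⟩ := b
    exact ⟨t, by rw [h2, ← ht]; simp⟩
  exact (List.suffix_of_suffix_length_le a' b' (by simp; omega)).eq_of_length (by simp; omega)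

lemma commute_aux (n : ℕ) : ∀ u v : List α, u.length + v.length ≤ n → u ++ v = v ++ u →
    ∃ (x : List α) (c d : ℕ), u = listPow x c ∧ v = listPow x d := by
  induction n with
  | zero =>
    intro u v h _
    have hu : u = [] := List.length_eq_zero_iff.mp (by omega)
    have hv : v = [] := List.length_eq_zero_iff.mp (by omega)
    exact ⟨[], 0, 0, by simp [hu, lp_zero], by simp [hv, lp_zero]⟩
  | succ n ih =>
    intro u v h e
    by_cases hu : u = []
    · exact ⟨v, 0, 1, by simp [hu, lp_zero], by simp [lp_one]⟩
    by_cases hv : v = []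
    · exact ⟨u, 1, 0, by simp [lp_one], by simp [hv, lp_zero]⟩
    have hu' := length_pos hu
    have hv' := length_pos hv
    rcases le_total u.length v.length with hl | hl
    · have : u <+: v := List.prefix_of_prefix_length_le ⟨v, rfl⟩ ⟨u, e.symm⟩ hl
      obtain ⟨t, rfl⟩ := this
      have e' : u ++ t = t ++ u := by
        have : u ++ (u ++ t) = u ++ (t ++ u) := by simpa using e
        exact List.append_cancel_left this
      obtain ⟨x, c, d, h1, h2⟩ := ih u t (by simp at h; omega) e'
      exact ⟨x, c, c + d, h1, by rw [lp_add, ← h1, ← h2]⟩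
    · have : v <+: u := List.prefix_of_prefix_length_le ⟨u, rfl⟩ ⟨v, e⟩ hl
      obtain ⟨t, rfl⟩ := this
      have e' : t ++ v = v ++ t := by
        have : v ++ (t ++ v) = v ++ (v ++ t) := by simpa using e
        exact List.append_cancel_left this
      obtain ⟨x, c, d, h1, h2⟩ := ih t v (by simp at h; omega) e'
      exact ⟨x, d + c, d, by rw [lp_add, ← h1, ← h2], h2⟩

lemma prim_root (n : ℕ) : ∀ x : List α, x.length ≤ n → x ≠ [] →
    ∃ (z : List α) (e : ℕ), IsPrimitive z ∧ x = listPow z e := by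
  induction n with
  | zero => intro x h hx; have := length_pos hx; omega
  | succ n ih =>
    intro x h hx
    by_cases hp : IsPower x
    · obtain ⟨k, hk, y, hy, rfl⟩ := hp
      have := length_pos hy
      rw [lp_length] at h
      obtain ⟨z, e, hz, rfl⟩ := ih y (by nlinarith) hy
      exact ⟨z, e * k, hz, by rw [lp_mul]⟩
    · exact ⟨x, 1, ⟨hx, hp⟩, by rw [lp_one]⟩

lemma commute_prim {u v : List α} (hu : u ≠ []) (e : u ++ v = v ++ u) :
    ∃ (x : List α) (c d : ℕ), IsPrimitive x ∧ u = listPow x c ∧ v = listPow x d := by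
  obtain ⟨x, c, d, h1, h2⟩ := commute_aux _ u v le_rfl e
  have hx : x ≠ [] := by rintro rfl; exact hu (by rw [h1, lp_nil])
  obtain ⟨z, m, hz, rfl⟩ := prim_root _ x le_rfl hx
  exact ⟨z, m * c, m * d, hz, by rw [lp_mul, h1], by rw [lp_mul, h2]⟩

lemma prim_dvd {x : List α} (hx : IsPrimitive x) {k m : ℕ} (hk : 2 ≤ k)
    (h : IsKPower k (listPow x m)) : k ∣ m := by
  obtain ⟨y, hy, e⟩ := h
  rcases Nat.lt_or_ge m 2 with hm | hm
  · interval_cases m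
    · simp
    · rw [lp_one] at e
      exact absurd ⟨k, hk, y, hy, e⟩ hx.2
  obtain ⟨k', rfl⟩ : ∃ k', k = k' + 1 := ⟨k - 1, by omega⟩
  obtain ⟨m', rfl⟩ : ∃ m', m = m' + 1 := ⟨m - 1, by omega⟩
  have hl := congrArg List.length e
  rw [lp_length, lp_length] at hl
  have c : x ++ y = y ++ x := by
    apply fw (s := listPow x (m' + 1)) (s1 := listPow y k') (s2 := listPow x m')
    · rw [e, lp_succ']
    · rw [e, lp_succ]; exact ⟨_, rfl⟩
    · rw [lp_succ']
    · rw [lp_succ]; exact ⟨_, rfl⟩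
    · rw [lp_length]; nlinarith
  obtain ⟨z, a, b, hz, h1, h2⟩ := commute_prim hx.1 c
  have ha : a = 1 := by
    rcases Nat.lt_or_ge a 2 with h | h
    · interval_cases a
      · exact absurd h1 hx.1
      · rfl
    · exact absurd ⟨a, h, z, hz.1, h1⟩ hx.2
  subst ha
  rw [lp_one] at h1
  subst h1
  rw [h2, lp_length] at hl
  have := length_pos hx.1
  refine ⟨b, ?_⟩
  have : (m' + 1) * x.length = ((k' + 1) * b) * x.length := by rw [hl]; ring
  exact Nat.eq_of_mul_eq_mul_right (by omega) this

lemma lp_conj (a b : List α) (n : ℕ) : a ++ listPow (b ++ a) n = listPow (a ++ b) n ++ a := by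
  induction n with
  | zero => simp [lp_zero]
  | succ n ih => rw [lp_succ, lp_succ]; simp only [List.append_assoc]; rw [ih]

lemma kpower_conj {k : ℕ} (hk : 1 ≤ k) (a b : List α) (h : IsKPower k (a ++ b)) :
    IsKPower k (b ++ a) := by
  obtain ⟨y, hy, e⟩ := h
  -- rotate one letter at a time
  have key : ∀ (a b y : List α), y ≠ [] → a ++ b = listPow y k → IsKPower k (b ++ a) := by
    intro a
    induction a with
    | nil => intro b y hy e; exact ⟨y, hy, by simpa using e⟩
    | cons c a ih =>
      intro b y hy e
      obtain ⟨k', rfl⟩ : ∃ k', k = k' + 1 := ⟨k - 1, by omega⟩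
      obtain ⟨d, t, rfl⟩ := List.exists_cons_of_ne_nil hy
      have e0 := e
      rw [lp_succ] at e
      simp only [List.cons_append, List.cons.injEq] at e
      obtain ⟨rfl, e⟩ := e
      have := ih (b ++ [c]) (t ++ [c]) (by simp) (by
        have h2 := lp_conj [c] t (k' + 1)
        have h3 : [c] ++ listPow (t ++ [c]) (k' + 1) = [c] ++ (a ++ (b ++ [c])) := by
          rw [h2, show [c] ++ t = c :: t from rfl, ← e0]; simp
        exact (List.append_cancel_left h3).symm)
      simpa using this
  exact key a b y hy e

lemma core {k : ℕ} (hk : 2 ≤ k) {p q r : List α} (hq : q ≠ [])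
    (h : ∀ n, IsKPower k (p ++ listPow q n ++ r)) :
    ∃ (x : List α) (a b : ℕ), IsPrimitive x ∧ 1 ≤ b ∧ q = listPow x (a * k) ∧
      r ++ p = listPow x (b * k) := by
  have h' : ∀ n, IsKPower k ((r ++ p) ++ listPow q n) := by
    intro n
    have := kpower_conj (by omega) _ _ (h n)
    simpa using this
  generalize hg : r ++ p = g at h' ⊢
  have hql := length_pos hq
  obtain ⟨y, hy, e⟩ := h' (g.length + 2)
  obtain ⟨k', rfl⟩ : ∃ k', k = k' + 1 := ⟨k - 1, by omega⟩
  have hl := congrArg List.length e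
  rw [List.length_append, lp_length, lp_length] at hl
  have hlen : q.length + y.length ≤ (g.length + 2) * q.length := by nlinarith
  have hs : listPow q (g.length + 2) <:+ listPow y (k' + 1) := ⟨g, e⟩
  have hys : y <:+ listPow y (k' + 1) := ⟨listPow y k', by rw [lp_succ']⟩
  obtain ⟨s1, hs1⟩ : y <:+ listPow q (g.length + 2) :=
    List.suffix_of_suffix_length_le hys hs (by rw [lp_length]; omega)
  have hs1' : s1 <:+ listPow y (k' + 1) := by
    have e2 : (g ++ s1) ++ y = listPow y k' ++ y := by
      rw [← lp_succ', ← e, ← hs1]; simp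
    have e3 := List.append_cancel_right e2
    exact ⟨y ++ g, by rw [lp_succ, ← e3]; simp⟩
  have c : q ++ y = y ++ q := by
    apply fw (s := listPow q (g.length + 2)) (s1 := s1) (s2 := listPow q (g.length + 1)) hs1.symm
    · refine List.suffix_of_suffix_length_le hs1' hs ?_
      rw [← hs1]; simp
    · rw [lp_succ']
    · rw [lp_succ q (g.length + 1)]; exact ⟨_, rfl⟩
    · rw [lp_length]; exact hlen
  obtain ⟨z, a, b, hz, h1, h2⟩ := commute_prim hq c
  have c2 : q ++ g = g ++ q := by
    apply List.append_cancel_right (bs := listPow q (g.length + 2))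
    have e4 : g ++ q ++ listPow q (g.length + 2) = (g ++ listPow q (g.length + 2)) ++ q := by
      rw [List.append_assoc, ← lp_succ, lp_succ', List.append_assoc]
    rw [e4, List.append_assoc, e, h1, h2, ← lp_mul, ← lp_add, ← lp_add, Nat.add_comm]
  obtain ⟨x, c, d, hx, rfl, rfl⟩ := commute_prim hq c2
  have d0 := h' 0
  rw [lp_zero, List.append_nil] at d0
  have d1 := h' 1
  rw [lp_one, ← lp_add] at d1
  have hd0 : d ≠ 0 := by
    rintro rfl
    obtain ⟨y, hy, e⟩ := d0
    have := congrArg List.length e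
    rw [lp_length, lp_length] at this
    have := length_pos hy
    nlinarith
  have k0 := prim_dvd hx hk d0
  have k1 := prim_dvd hx hk d1
  obtain ⟨a, rfl⟩ := (Nat.dvd_add_right k0).mp k1
  obtain ⟨b, rfl⟩ := k0
  refine ⟨x, a, b, hx, ?_, by rw [Nat.mul_comm], by rw [Nat.mul_comm]⟩
  rcases Nat.eq_zero_or_pos b with rfl | hb
  · simp at hd0
  · exact hb

lemma core' {k : ℕ} (hk : 2 ≤ k) {p q r : List α}
    (h : ∀ n, IsKPower k (p ++ listPow q n ++ r)) :
    ∃ (x : List α) (a b : ℕ), IsPrimitive x ∧ 1 ≤ b ∧ q = listPow x (a * k) ∧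
      r ++ p = listPow x (b * k) := by
  by_cases hq : q = []
  · subst hq
    have h0 := h 0
    rw [lp_zero, List.append_nil] at h0
    obtain ⟨y, hy, e⟩ := kpower_conj (by omega) _ _ h0
    obtain ⟨x, b, hx, rfl⟩ := prim_root _ y le_rfl hy
    refine ⟨x, 0, b, hx, ?_, by rw [Nat.zero_mul, lp_zero], by rw [e, lp_mul]⟩
    rcases Nat.eq_zero_or_pos b with rfl | hb
    · simp [lp_zero] at hy
    · exact hb
  · exact core hk hq h

lemma prefix_pow (x : List α) (d : ℕ) : ∀ r : List α, r <+: listPow x d →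
    ∃ (e : ℕ) (t : List α), r = listPow x e ++ t ∧ t.length ≤ x.length := by
  induction d with
  | zero =>
    intro r h
    rw [lp_zero, List.prefix_nil] at h
    exact ⟨0, [], by simp [h, lp_zero], by simp⟩
  | succ d ih =>
    intro r h
    rcases le_total r.length x.length with hl | hl
    · exact ⟨0, r, by simp [lp_zero], hl⟩
    · rw [lp_succ] at h
      have : x <+: r := List.prefix_of_prefix_length_le ⟨_, rfl⟩ h hl
      obtain ⟨r', rfl⟩ := this
      obtain ⟨e, t, h1, h2⟩ := ih r' ((List.prefix_append_right_inj x).mp h)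
      exact ⟨e + 1, t, by rw [lp_succ, h1]; simp, h2⟩

lemma eval_pow {σ : Type*} (M : DFA α σ) (x : List α) (n : ℕ) (s : σ) :
    M.evalFrom s (listPow x n) = (fun s => M.evalFrom s x)^[n] s := by
  induction n generalizing s with
  | zero => simp [lp_zero]
  | succ n ih => rw [lp_succ, DFA.evalFrom_of_append, ih, Function.iterate_succ_apply]

lemma iter_periodic {σ : Type*} [Finite σ] (f : σ → σ) :
    ∃ i j : ℕ, i < j ∧ j ≤ Nat.card (σ → σ) ∧ f^[i] = f^[j] := by
  have : Fintype (σ → σ) := Fintype.ofFinite _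
  obtain ⟨a, b, hab, e⟩ := Fintype.exists_ne_map_eq_of_card_lt
    (fun n : Fin (Nat.card (σ → σ) + 1) => f^[(n : ℕ)]) (by simp)
  rcases lt_or_gt_of_ne hab with h | h
  · exact ⟨a, b, h, by omega, e⟩
  · exact ⟨b, a, h, by omega, e.symm⟩

lemma finite_letters {σ : Type*} [Finite σ] (M : DFA α σ) {k : ℕ} (hk : 2 ≤ k)
    (h : ∀ y ∈ M.accepts, IsKPower k y) : {a | ∃ y ∈ M.accepts, a ∈ y}.Finite := by
  classical
  apply Set.Finite.of_finite_image (f := fun a => fun q => M.step q a) (Set.toFinite _)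
  rintro a ⟨y, hy, ha⟩ b _ hab
  by_contra hne
  obtain ⟨s, t, rfl⟩ := List.append_of_mem ha
  have hy2 : s ++ b :: t ∈ M.accepts := by
    have : M.eval (s ++ b :: t) = M.eval (s ++ a :: t) := by
      simp only [DFA.eval, DFA.evalFrom_of_append]
      have := congrFun hab (M.evalFrom M.start s)
      simp only at this
      simp [DFA.evalFrom]
      simp [DFA.evalFrom] at this
      rw [this]
    rw [DFA.mem_accepts] at hy ⊢
    rwa [this]
  have cnt : ∀ y, IsKPower k y → k ∣ y.count a := by
    rintro _ ⟨x, _, rfl⟩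
    refine ⟨x.count a, ?_⟩
    simp [listPow, List.count_flatten]
  have c1 := cnt _ (h _ hy)
  have c2 := cnt _ (h _ hy2)
  rw [List.count_append, List.count_cons_self] at c1
  rw [List.count_append, List.count_cons_of_ne (Ne.symm hne)] at c2
  have : k ∣ 1 := by
    rw [← Nat.add_assoc] at c1
    exact (Nat.dvd_add_right c2).mp c1
  have := Nat.le_of_dvd one_pos this
  omega

lemma finite_words {A : Set α} (hA : A.Finite) (B : ℕ) :
    {l : List α | l.length ≤ B ∧ ∀ a ∈ l, a ∈ A}.Finite := by
  have : Finite A := hA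
  refine ((List.finite_length_le A B).image (List.map Subtype.val)).subset ?_
  rintro l ⟨hl, h⟩
  refine ⟨l.pmap Subtype.mk h, by simpa using hl, by simp [List.map_pmap]⟩

/-- Every accepted word lies in a bounded accepted family. -/
lemma cover {σ : Type*} [Fintype σ] (M : DFA α σ) {k : ℕ} (hk : 2 ≤ k)
    (h : ∀ y ∈ M.accepts, IsKPower k y) : ∃ B : ℕ, ∀ y ∈ M.accepts, ∃ u v w : List α,
      u.length ≤ B ∧ v.length ≤ B ∧ w.length ≤ B ∧
      (∀ n, u ++ listPow v n ++ w ∈ M.accepts) ∧ ∃ n, y = u ++ listPow v n ++ w := by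
  set N := Fintype.card σ
  set K := Nat.card (σ → σ)
  refine ⟨2 * N + K * N, fun y hy => ?_⟩
  have single : y.length ≤ 2 * N + K * N → ∃ u v w : List α,
      u.length ≤ 2 * N + K * N ∧ v.length ≤ 2 * N + K * N ∧ w.length ≤ 2 * N + K * N ∧
      (∀ n, u ++ listPow v n ++ w ∈ M.accepts) ∧ ∃ n, y = u ++ listPow v n ++ w := fun hl =>
    ⟨y, [], [], hl, by simp, by simp, fun n => by simpa [lp_nil] using hy, 0, by simp [lp_nil]⟩
  rcases Nat.lt_or_ge y.length N with hl | hl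
  · exact single (by nlinarith [Nat.zero_le (K * N)])
  obtain ⟨p, q, r, rfl, hpq, hq, hsub⟩ := M.pumping_lemma hy hl
  have hpump : ∀ n, p ++ listPow q n ++ r ∈ M.accepts := by
    intro n
    apply hsub
    refine Language.mem_mul.mpr ⟨p ++ listPow q n, Language.mem_mul.mpr ⟨p, rfl, listPow q n, ?_, rfl⟩, r, rfl, rfl⟩
    exact Language.mem_kstar.mpr ⟨List.replicate n q, rfl, fun y hy => List.eq_of_mem_replicate hy⟩
  obtain ⟨x, a, b, hx, hb, hqx, hrp⟩ := core hk hq fun n => h _ (hpump n)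
  obtain ⟨e, t, hr, ht⟩ := prefix_pow x _ r ⟨p, hrp⟩
  have hxN : x.length ≤ N := by
    have h1 := congrArg List.length hqx
    rw [lp_length] at h1
    have h2 := length_pos hq
    have : 1 ≤ a * k := by
      rcases Nat.eq_zero_or_pos (a * k) with h | h
      · rw [h] at h1; omega
      · exact h
    have : x.length ≤ a * k * x.length := Nat.le_mul_of_pos_left _ this
    omega
  have hform : p ++ q ++ r = p ++ listPow x (a * k + e) ++ t := by
    rw [hqx, hr, lp_add]; simp
  generalize a * k + e = n at hform
  rw [hform] at hy single ⊢
  obtain ⟨i, j, hij, hjK, hper⟩ := iter_periodic (fun s => M.evalFrom s x)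
  change j ≤ K at hjK
  have hbd : ∀ m, m ≤ K → (listPow x m).length ≤ K * N := fun m hm => by
    rw [lp_length]; exact Nat.mul_le_mul hm hxN
  rcases Nat.lt_or_ge n i with hn | hn
  · apply single
    have := hbd n (by omega)
    simp only [List.length_append]
    omega
  obtain ⟨T, rfl⟩ : ∃ T, j = i + T := ⟨j - i, by omega⟩
  have hT : 0 < T := by omega
  set f := (fun s => M.evalFrom s x) with hf
  have hmod := Nat.mod_lt (n - i) hT
  have hdm := Nat.mod_add_div (n - i) T
  set m0 := (n - i) % T
  set g := (n - i) / T
  have hnn : n = i + m0 + T * g := by omega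
  have hp2 : ∀ c, f^[i + m0 + T * c] = f^[i + m0] := by
    intro c
    induction c with
    | zero => simp
    | succ c ih =>
      rw [show i + m0 + T * (c + 1) = (m0 + T * c) + (i + T) by ring, Function.iterate_add, ← hper,
        ← Function.iterate_add, ← ih]
      congr 1; ring
  refine ⟨p ++ listPow x (i + m0), listPow x T, t, ?_, ?_, ?_, ?_, g, ?_⟩
  · have := hbd (i + m0) (by omega)
    simp only [List.length_append]
    omega
  · have := hbd T (by omega)
    omega
  · omega
  · intro c
    rw [DFA.mem_accepts] at hy ⊢
    rw [← lp_mul, List.append_assoc p, ← lp_add]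
    have : M.eval (p ++ listPow x (i + m0 + T * c) ++ t) = M.eval (p ++ listPow x n ++ t) := by
      simp only [DFA.eval, DFA.evalFrom_of_append, eval_pow]
      rw [← hf, hp2, hnn, hp2]
    rwa [this]
  · rw [hnn, lp_add, lp_mul]; simp

end KPow

/-- A regular language consists only of k-powers iff it is a finite union of languages
u·v*·w where v = x^(ik) and w·u = x^(jk) for a primitive word x and integers
i ≥ 0, j ≥ 1. -/
theorem regular_all_kpowers_characterization {α : Type*} (L : Language α)
    (hreg : L.IsRegular) (k : ℕ) (hk : 2 ≤ k) :
    (∀ y ∈ L, IsKPower k y) ↔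
      ∃ (m : ℕ) (u v w : Fin m → List α),
        (∀ y, y ∈ L ↔ ∃ (i : Fin m) (j : ℕ), y = u i ++ listPow (v i) j ++ w i) ∧
        ∀ i : Fin m, ∃ (x : List α) (a b : ℕ), IsPrimitive x ∧ 1 ≤ b ∧
          v i = listPow x (a * k) ∧ w i ++ u i = listPow x (b * k) := by
  constructor
  · intro h
    obtain ⟨σ, _, M, rfl⟩ := hreg
    obtain ⟨B, hB⟩ := KPow.cover M hk h
    let A : Set α := {a | ∃ y ∈ M.accepts, a ∈ y}
    have hA : A.Finite := KPow.finite_letters M hk h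
    let W : Set (List α) := {l | l.length ≤ B ∧ ∀ a ∈ l, a ∈ A}
    have hW : W.Finite := KPow.finite_words hA B
    let G : Set (List α × List α × List α) :=
      {t | t ∈ W ×ˢ (W ×ˢ W) ∧ ∀ n, t.1 ++ listPow t.2.1 n ++ t.2.2 ∈ M.accepts}
    have hG : Finite G := ((hW.prod (hW.prod hW)).subset fun t ht => ht.1).to_subtype
    obtain ⟨m, ⟨E⟩⟩ := Finite.exists_equiv_fin G
    refine ⟨m, fun i => (E.symm i).1.1, fun i => (E.symm i).1.2.1, fun i => (E.symm i).1.2.2,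
      fun y => ⟨fun hy => ?_, ?_⟩, fun i => ?_⟩
    · obtain ⟨u, v, w, hu, hv, hw, hm, n, rfl⟩ := hB y hy
      have h1 := hm 1
      rw [KPow.lp_one] at h1
      have hmem : ((u, v, w) : List α × List α × List α) ∈ G := by
        refine ⟨⟨⟨hu, fun a ha => ?_⟩, ⟨hv, fun a ha => ?_⟩, ⟨hw, fun a ha => ?_⟩⟩, hm⟩ <;>
        exact ⟨_, h1, by simp [ha]⟩
      exact ⟨E ⟨_, hmem⟩, n, by simp⟩
    · rintro ⟨i, n, rfl⟩
      exact (E.symm i).2.2 n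
    · exact KPow.core' hk fun n => h _ ((E.symm i).2.2 n)
  · rintro ⟨m, u, v, w, hL, hx⟩ y hy
    obtain ⟨i, j, rfl⟩ := (hL y).mp hy
    obtain ⟨x, a, b, hp, hb, hv, hwu⟩ := hx i
    have : IsKPower k (w i ++ (u i ++ listPow (v i) j)) := by
      refine ⟨listPow x (b + a * j), ?_, ?_⟩
      · intro h0
        have := congrArg List.length h0
        rw [KPow.lp_length] at this
        have h3 := KPow.length_pos hp.1
        simp at this
        rcases this with h | h
        · omega
        · exact hp.1 h
      · rw [← List.append_assoc, hwu, hv, ← KPow.lp_mul, ← KPow.lp_add, ← KPow.lp_mul]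
        congr 1; ring
    exact KPow.kpower_conj (by omega) _ _ this
end

section
/- Let L be the language accepted by an NFA with n states and let k ≥ 2 be an integer. If L contains a word of length at least n that is not a k-power, then L contains infinitely many words that are not k-powers. -/
theorem fm_len_inj {α : Type*} {u v c d : FreeMonoid α} (h : u * c = v * d)
    (hl : u.length = v.length) : u = v :=
  (List.append_inj (show (FreeMonoid.toList u ++ FreeMonoid.toList c : List α) =
    FreeMonoid.toList v ++ FreeMonoid.toList d from h) hl).1

theorem fm_pref {α : Type*} {u v c d : FreeMonoid α} (h : u * c = v * d)
    (hl : u.length ≤ v.length) : ∃ e, v = u * e := by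
  have h' : (FreeMonoid.toList u ++ FreeMonoid.toList c : List α) =
    FreeMonoid.toList v ++ FreeMonoid.toList d := h
  have h1 : FreeMonoid.toList u <+: FreeMonoid.toList v :=
    List.prefix_of_prefix_length_le (List.prefix_append _ _)
      (by rw [h']; exact List.prefix_append _ _) hl
  obtain ⟨e, he⟩ := h1
  exact ⟨e, he.symm⟩

theorem fm_len_pow {α : Type*} (u : FreeMonoid α) (k : ℕ) :
    (u ^ k).length = k * u.length := by
  induction k with
  | zero => simp
  | succ k ih => rw [pow_succ, FreeMonoid.length_mul, ih]; ring

theorem fm_stepA {α : Type*} {b t x : FreeMonoid α} {i k : ℕ} (hb : 1 ≤ b.length)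
    (hk : 2 ≤ k) (hi : t.length + 2 + k ≤ i) (h : b ^ i * t = x ^ k) :
    b * x = x * b ∧ ∃ e, b ^ i = x * e := by
  have hlen : i * b.length + t.length = k * x.length := by
    have := congrArg FreeMonoid.length h
    simpa [fm_len_pow] using this
  have h1 : b.length ≤ x.length := by
    have : k * b.length ≤ k * x.length := by nlinarith
    exact Nat.le_of_mul_le_mul_left this (by omega)
  have h2 : x.length + b.length ≤ i * b.length := by
    have : 2 * x.length ≤ k * x.length := Nat.mul_le_mul_right _ hk
    nlinarith
  obtain ⟨m, rfl⟩ : ∃ m, k = m + 2 := ⟨k - 2, by omega⟩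
  obtain ⟨j, rfl⟩ : ∃ j, i = j + 1 := ⟨i - 1, by omega⟩
  have hx : x ^ (m + 2) = x * (x * x ^ m) := by
    rw [← mul_assoc, ← pow_two, ← pow_add, add_comm]
  rw [hx] at h
  obtain ⟨e, he⟩ := fm_pref h.symm (by rw [fm_len_pow]; omega)
  obtain ⟨g, hg⟩ := fm_pref (u := b) (v := x) (c := b ^ j * t)
    (by rw [← h, ← mul_assoc, ← pow_succ']) h1
  obtain ⟨f, hf⟩ := fm_pref (u := x * b) (v := b ^ (j + 1)) (c := g * x ^ m) (d := t)
    (by rw [h]; conv_rhs => rw [show x * (x * x ^ m) = x * ((b * g) * x ^ m) by rw [← hg]]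
        simp only [mul_assoc])
    (by rw [fm_len_pow, FreeMonoid.length_mul]; omega)
  refine ⟨fm_len_inj (c := e) (d := f * b) ?_ ?_, e, he⟩
  · rw [mul_assoc, ← he, ← mul_assoc, ← hf, ← pow_succ, ← pow_succ']
  · simp only [FreeMonoid.length_mul]; omega

theorem fm_key {α : Type*} {b t x y : FreeMonoid α} {i k : ℕ} (hb : 1 ≤ b.length)
    (hk : 2 ≤ k) (hi : t.length + 2 + k ≤ i) (hx : b ^ i * t = x ^ k)
    (hy : b ^ (i + 1) * t = y ^ k) : ∃ z, b * t = z ^ k := by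
  obtain ⟨hbx, e, he⟩ := fm_stepA hb hk hi hx
  obtain ⟨hby, e', he'⟩ := fm_stepA hb hk (by omega) hy
  have hlx : i * b.length + t.length = k * x.length := by
    simpa [fm_len_pow] using congrArg FreeMonoid.length hx
  have hly : (i + 1) * b.length + t.length = k * y.length := by
    simpa [fm_len_pow] using congrArg FreeMonoid.length hy
  have hxy : x.length ≤ y.length := by
    have : k * x.length ≤ k * y.length := by nlinarith
    exact Nat.le_of_mul_le_mul_left this (by omega)
  obtain ⟨d, rfl⟩ := fm_pref (u := x) (v := y) (c := e * b) (d := e')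
    (by rw [← he', ← mul_assoc, ← he, pow_succ]) hxy
  have hd : b.length = k * d.length := by
    rw [FreeMonoid.length_mul] at hly; nlinarith
  have hbd : Commute b d := by
    have : x * (b * d) = x * (d * b) := by
      rw [← mul_assoc, ← hbx, mul_assoc, hby, mul_assoc]
    exact mul_left_cancel this
  have hbk : b = d ^ k := fm_len_inj (hbd.pow_right k).eq (by rw [fm_len_pow, hd])
  have hdx : x * d = d * x := by
    refine fm_len_inj (c := e' * d) (d := e * b) ?_ ?_
    · rw [← mul_assoc, ← he', mul_assoc d, ← mul_assoc x, ← he, ← pow_succ]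
      exact (hbd.pow_left _).eq
    · simp only [FreeMonoid.length_mul]; omega
  obtain ⟨f, hf⟩ := fm_pref (u := d ^ i) (v := x) (c := d ^ ((k - 1) * i)) (d := e)
    (by rw [← he, hbk, ← pow_mul, ← pow_add]
        congr 1
        obtain ⟨m, rfl⟩ : ∃ m, k = m + 2 := ⟨k - 2, by omega⟩
        simp only [show m + 2 - 1 = m + 1 from rfl]; ring)
    (by rw [fm_len_pow]
        have : k * (i * d.length) ≤ k * x.length := by rw [hd] at hlx; nlinarith
        exact Nat.le_of_mul_le_mul_left this (by omega))
  have hdf : Commute d f := by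
    have : d ^ i * (d * f) = d ^ i * (f * d) := by
      rw [← mul_assoc, ← pow_succ, pow_succ', mul_assoc, ← hf, ← hdx, hf, mul_assoc]
    exact mul_left_cancel this
  have ht : t = f ^ k := by
    have : b ^ i * t = b ^ i * f ^ k := by
      rw [hx, hf, (hdf.pow_left i).mul_pow, hbk, ← pow_mul, ← pow_mul, mul_comm i k]
    exact mul_left_cancel this
  exact ⟨d * f, by rw [hdf.mul_pow, ← hbk, ← ht]⟩

theorem fm_pow_conj {α : Type*} (p q : FreeMonoid α) (k : ℕ) :
    (p * q) ^ k * p = p * (q * p) ^ k := by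
  induction k with
  | zero => simp
  | succ k ih => rw [pow_succ', mul_assoc, ih, pow_succ']; simp only [mul_assoc]

theorem fm_conj {α : Type*} {k : ℕ} (hk : k ≠ 0) (u : FreeMonoid α) :
    ∀ (v x : FreeMonoid α), u * v = x ^ k → ∃ z, v * u = z ^ k := by
  induction u using FreeMonoid.inductionOn' with
  | one => intro v x h; exact ⟨x, by simpa using h⟩
  | of_mul a u ih =>
    intro v x h
    obtain ⟨j, rfl⟩ : ∃ j, k = j + 1 := ⟨k - 1, by omega⟩
    obtain ⟨x', rfl⟩ := fm_pref (u := FreeMonoid.of a) (v := x) (c := u * v) (d := x ^ j)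
      (by rw [← pow_succ', ← h, mul_assoc])
      (by
        rw [FreeMonoid.length_of]
        by_contra hx
        have hl := congrArg FreeMonoid.length h
        have h0 : x.length = 0 := by omega
        simp [fm_len_pow, h0] at hl)
    have := ih (v * FreeMonoid.of a) (x' * FreeMonoid.of a) (by
      apply mul_left_cancel (a := FreeMonoid.of a)
      rw [← fm_pow_conj, ← h]; simp only [mul_assoc])
    simpa only [mul_assoc] using this

theorem fm_listPow {α : Type*} (x : List α) (k : ℕ) :
    listPow x k = FreeMonoid.toList (FreeMonoid.ofList x ^ k) := by
  induction k with
  | zero => rfl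
  | succ k ih =>
    rw [pow_succ', FreeMonoid.toList_mul, ← ih]
    simp [listPow, List.replicate_succ]

theorem nfa_run {α σ : Type*} (M : NFA α σ) (w : List α) : ∀ (S : Set σ) (t : σ),
    t ∈ M.evalFrom S w → ∃ q : ℕ → σ, q 0 ∈ S ∧ q w.length = t ∧
      ∀ u a z, w = u ++ a :: z → q (u.length + 1) ∈ M.step (q u.length) a := by
  induction w with
  | nil => intro S t h; exact ⟨fun _ => t, h, rfl, by simp⟩
  | cons a w ih =>
    intro S t h
    obtain ⟨q, h0, h1, h2⟩ := ih _ _ h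
    obtain ⟨s, hs, hq⟩ := NFA.mem_stepSet.1 h0
    refine ⟨fun i => Nat.casesOn i s q, hs, h1, ?_⟩
    intro u a' z hu
    cases u with
    | nil =>
      simp only [List.nil_append, List.cons.injEq] at hu
      rw [← hu.1]; exact hq
    | cons x u =>
      simp only [List.cons_append, List.cons.injEq] at hu
      exact h2 u a' z hu.2

theorem nfa_run_seg {α σ : Type*} (M : NFA α σ) (w : List α) (q : ℕ → σ)
    (h : ∀ u a z, w = u ++ a :: z → q (u.length + 1) ∈ M.step (q u.length) a)
    (v : List α) : ∀ u z, w = u ++ v ++ z →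
      q (u.length + v.length) ∈ M.evalFrom {q u.length} v := by
  induction v with
  | nil => intro u z _; simp
  | cons a v ih =>
    intro u z hw
    have h1 := h u a (v ++ z) (by simpa using hw)
    have h2 := ih (u ++ [a]) z (by simpa using hw)
    rw [NFA.evalFrom_cons, NFA.mem_evalFrom_iff_exists]
    refine ⟨q (u.length + 1), by simpa using h1, ?_⟩
    simp only [List.length_append, List.length_cons, List.length_nil, zero_add] at h2
    rw [List.length_cons, show u.length + (v.length + 1) = u.length + 1 + v.length by omega]
    exact h2

theorem nfa_pump {α σ : Type*} [Fintype σ] (M : NFA α σ) (w : List α) (hw : w ∈ M.accepts)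
    (hlen : Fintype.card σ ≤ w.length) : ∃ a b c, w = a ++ b ++ c ∧ b ≠ [] ∧
      ∀ m, a ++ listPow b m ++ c ∈ M.accepts := by
  obtain ⟨t, ht, hte⟩ := hw
  obtain ⟨q, h0, h1, h2⟩ := nfa_run M w _ t hte
  have hseg := nfa_run_seg M w q h2
  obtain ⟨i, j, hij, hq⟩ : ∃ i j : Fin (w.length + 1), i < j ∧ q i = q j := by
    obtain ⟨i, j, hne, hq⟩ := Fintype.exists_ne_map_eq_of_card_lt
      (fun i : Fin (w.length + 1) => q i) (by simp; omega)
    rcases lt_or_gt_of_ne hne with h | h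
    · exact ⟨i, j, h, hq⟩
    · exact ⟨j, i, h, hq.symm⟩
  have hij' : (i : ℕ) < j := hij
  have hj : (j : ℕ) ≤ w.length := by omega
  obtain ⟨a, b, c, hw, ha, hb⟩ : ∃ a b c, w = a ++ b ++ c ∧ a.length = i ∧
      a.length + b.length = j := by
    refine ⟨w.take i, (w.drop i).take (j - i), (w.drop i).drop (j - i), ?_, ?_, ?_⟩
    · rw [List.append_assoc, List.take_append_drop, List.take_append_drop]
    · simp; omega
    · simp; omega
  refine ⟨a, b, c, hw, by rintro rfl; simp at hb; omega, ?_⟩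
  have e1 := hseg a [] (b ++ c) (by simp [hw])
  have e2 := hseg b a c hw
  have e3 := hseg c (a ++ b) [] (by simp [hw])
  simp only [List.length_nil, zero_add, List.length_append] at e1 e3
  rw [hb, ha, ← hq] at e2
  rw [hb, ← hq] at e3
  rw [ha] at e1
  have hl : j + c.length = w.length := by
    have := congrArg List.length hw
    simp only [List.length_append] at this
    omega
  rw [hl, h1] at e3
  have hloop : ∀ m, q i ∈ M.evalFrom {q i} (listPow b m) := by
    intro m
    induction m with
    | zero => simp [listPow]
    | succ m ih =>
      have : listPow b (m + 1) = b ++ listPow b m := by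
        simp [listPow, List.replicate_succ]
      rw [this, NFA.evalFrom_append, NFA.mem_evalFrom_iff_exists]
      exact ⟨_, e2, ih⟩
  intro m
  refine ⟨t, ht, ?_⟩
  rw [NFA.eval, NFA.evalFrom_append, NFA.mem_evalFrom_iff_exists]
  refine ⟨q i, ?_, e3⟩
  rw [NFA.evalFrom_append, NFA.mem_evalFrom_iff_exists]
  refine ⟨q i, ?_, hloop m⟩
  rw [NFA.mem_evalFrom_iff_exists]
  exact ⟨q 0, h0, e1⟩

/-- If the language of an n-state NFA contains a non-k-power of length ≥ n, then it
contains infinitely many non-k-powers. -/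
theorem nfa_infinitely_many_non_kpowers {α σ : Type*} [Fintype σ] (M : NFA α σ) (n : ℕ)
    (hn : Fintype.card σ = n) (k : ℕ) (hk : 2 ≤ k)
    (h : ∃ w ∈ M.accepts, n ≤ w.length ∧ ¬ IsKPower k w) :
    {w | w ∈ M.accepts ∧ ¬ IsKPower k w}.Infinite := by
  obtain ⟨w, hw, hlen, hnk⟩ := h
  obtain ⟨a, b, c, rfl, hb, hsub⟩ := nfa_pump M w hw (hn ▸ hlen)
  intro hfin
  have hb1 : 1 ≤ b.length := List.length_pos_iff.2 hb
  let A : FreeMonoid α := FreeMonoid.ofList a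
  let B : FreeMonoid α := FreeMonoid.ofList b
  let C : FreeMonoid α := FreeMonoid.ofList c
  have hB1 : 1 ≤ B.length := hb1
  let f : ℕ → List α := fun i => FreeMonoid.toList (A * B ^ i * C)
  have hinj : Function.Injective f := by
    intro i j hij
    have h1 : A * B ^ i * C = A * B ^ j * C := hij
    have h2 := congrArg FreeMonoid.length h1
    simp only [FreeMonoid.length_mul, fm_len_pow] at h2
    have h3 : i * B.length = j * B.length := by omega
    exact Nat.eq_of_mul_eq_mul_right hB1 h3
  have hmem : ∀ i, f i ∈ M.accepts := by
    intro i
    have hf : f i = a ++ listPow b i ++ c := by rw [fm_listPow]; rfl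
    rw [hf]
    exact hsub i
  obtain ⟨N, hN⟩ := (hfin.preimage (hinj.injOn)).bddAbove
  have hpow : ∀ i, N < i → ∃ x : FreeMonoid α, B ^ i * (C * A) = x ^ k := by
    intro i hi
    by_cases hp : IsKPower k (f i)
    · obtain ⟨x, -, hx⟩ := hp
      rw [fm_listPow] at hx
      have hx' : A * (B ^ i * C) = (FreeMonoid.ofList x) ^ k := by
        rw [← mul_assoc]; exact hx
      obtain ⟨z, hz⟩ := fm_conj (by omega) _ _ _ hx'
      exact ⟨z, by rw [← hz, mul_assoc]⟩
    · have : i ≤ N := hN (show f i ∈ {w | w ∈ M.accepts ∧ ¬ IsKPower k w} from ⟨hmem i, hp⟩)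
      omega
  obtain ⟨x, hx⟩ := hpow (N + 1 + ((C * A).length + 2 + k)) (by omega)
  obtain ⟨y, hy⟩ := hpow (N + 1 + ((C * A).length + 2 + k) + 1) (by omega)
  obtain ⟨z, hz⟩ := fm_key hB1 hk (by omega) hx hy
  rw [← mul_assoc] at hz
  obtain ⟨z', hz'⟩ := fm_conj (by omega) _ _ _ hz
  apply hnk
  refine ⟨FreeMonoid.toList z', ?_, ?_⟩
  · rintro h0
    have h1 : z' = 1 := h0
    rw [h1, one_pow] at hz'
    have := congrArg FreeMonoid.length hz'
    simp only [FreeMonoid.length_mul, FreeMonoid.length_one] at this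
    omega
  · rw [fm_listPow]
    have : a ++ b ++ c = FreeMonoid.toList (A * (B * C)) := by
      rw [← mul_assoc]; rfl
    rw [this, hz']; rfl
end

section
/- Let M be an NFA with n states and let ℓ ≥ 0 be an integer such that every word in L(M) of length at least ℓ is a power. Then for every integer r ≥ ℓ, the number of words of length r in L(M) is at most 7n. -/
/-- `w` is a power of a word of length `p`. -/
def Per {α : Type*} (w : List α) (p : ℕ) : Prop :=
  0 < p ∧ p ∣ w.length ∧ ∀ i < w.length, w[i]? = w[i % p]?

theorem Per.mono {α : Type*} {w : List α} {p q : ℕ} (h : Per w p) (hpq : p ∣ q) (hq : 0 < q)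
    (hqw : q ∣ w.length) : Per w q := by
  refine ⟨hq, hqw, fun i hi => ?_⟩
  have h2 : i % q < w.length := lt_of_le_of_lt (Nat.mod_le _ _) hi
  rw [h.2.2 i hi, h.2.2 _ h2, Nat.mod_mod_of_dvd _ hpq]

theorem getElem?_rot {α : Type*} (u v : List α) (i : ℕ) (hi : i < v.length + u.length) :
    (v ++ u)[i]? = (u ++ v)[(i + u.length) % (u ++ v).length]? := by
  rw [List.length_append]
  by_cases h : i < v.length
  · rw [Nat.mod_eq_of_lt (by omega), List.getElem?_append_left h,
      List.getElem?_append_right (by omega)]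
    congr 1; omega
  · have : (i + u.length) % (u.length + v.length) = i - v.length := by
      rw [Nat.mod_eq_sub_mod (by omega), Nat.mod_eq_of_lt (by omega)]; omega
    rw [this, List.getElem?_append_right (by omega), List.getElem?_append_left (by omega)]

theorem Per.rot {α : Type*} {u v : List α} {p : ℕ} (h : Per (u ++ v) p) : Per (v ++ u) p := by
  obtain ⟨h0, h1, h2⟩ := h
  refine ⟨h0, by simpa [add_comm] using h1, fun i hi => ?_⟩
  rw [List.length_append] at hi
  have hi2 : i % p < v.length + u.length := lt_of_le_of_lt (Nat.mod_le _ _) hi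
  have hpos : 0 < (u ++ v).length := by rw [List.length_append]; omega
  rw [getElem?_rot u v i hi, getElem?_rot u v _ hi2, h2 _ (Nat.mod_lt _ hpos),
    h2 ((i % p + u.length) % _) (Nat.mod_lt _ hpos), Nat.mod_mod_of_dvd _ h1,
    Nat.mod_mod_of_dvd _ h1, Nat.mod_add_mod]

theorem listPow_length {α : Type*} (x : List α) (k : ℕ) :
    (listPow x k).length = k * x.length := by
  simp [listPow]

theorem listPow_getElem? {α : Type*} (x : List α) (k i : ℕ) (hi : i < k * x.length) :
    (listPow x k)[i]? = x[i % x.length]? := by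
  induction k generalizing i with
  | zero => simp at hi
  | succ k ih =>
    have e : listPow x (k + 1) = x ++ listPow x k := by
      simp [listPow, List.replicate_succ]
    rw [e]
    by_cases h : i < x.length
    · rw [List.getElem?_append_left h, Nat.mod_eq_of_lt h]
    · rw [Nat.add_mul] at hi
      rw [List.getElem?_append_right (by omega), ih _ (by omega),
        ← Nat.mod_eq_sub_mod (by omega)]

theorem IsPower.per {α : Type*} {w : List α} (h : IsPower w) :
    ∃ k p, 2 ≤ k ∧ w.length = k * p ∧ Per w p := by
  obtain ⟨k, hk, x, hx, rfl⟩ := h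
  have hpos : 0 < x.length := List.length_pos_iff.2 hx
  refine ⟨k, x.length, hk, listPow_length x k, hpos, ⟨k, ?_⟩, fun i hi => ?_⟩
  · rw [listPow_length, mul_comm]
  · have h2 : i % x.length < k * x.length := by
      rw [listPow_length] at hi
      exact lt_of_le_of_lt (Nat.mod_le _ _) hi
    rw [listPow_length] at hi
    rw [listPow_getElem? x k i hi, listPow_getElem? x k _ h2, Nat.mod_mod]

theorem Per.getElem?_left {α : Type*} {u v : List α} {p : ℕ} (h : Per (u ++ v) p)
    (hp : p ≤ u.length) (i : ℕ) (hi : i < u.length + v.length) :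
    (u ++ v)[i]? = u[i % p]? := by
  rw [h.2.2 i (by rw [List.length_append]; omega), List.getElem?_append_left]
  exact lt_of_lt_of_le (Nat.mod_lt _ h.1) hp

theorem Per.left {α : Type*} {u v : List α} {p : ℕ} (h : Per (u ++ v) p)
    (hp : p ≤ u.length) : u.HasPeriod p := by
  rw [List.hasPeriod_iff_forall_getElem?_mod]
  intro i hi
  rw [← h.getElem?_left hp i (by omega), List.getElem?_append_left hi]

theorem eq_of_append {α : Type*} {u v v' : List α} (hl : v.length = v'.length)
    (h : ∀ i < u.length + v.length, (u ++ v)[i]? = (u ++ v')[i]?) : v = v' := by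
  have : u ++ v = u ++ v' := by
    apply List.ext_getElem?
    intro i
    by_cases hi : i < u.length + v.length
    · exact h i hi
    · rw [List.getElem?_eq_none (by rw [List.length_append]; omega),
        List.getElem?_eq_none (by rw [List.length_append]; omega)]
  exact List.append_cancel_left this

theorem row_same {α : Type*} {u v v' : List α} {p : ℕ} (hl : v.length = v'.length)
    (h : Per (u ++ v) p) (h' : Per (u ++ v') p) (hp : p ≤ u.length) : v = v' := by
  apply eq_of_append hl
  intro i hi
  rw [h.getElem?_left hp i hi, h'.getElem?_left hp i (by omega)]

theorem row_diff {α : Type*} {u v v' : List α} {p q : ℕ} (hl : v.length = v'.length)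
    (h : Per (u ++ v) p) (h' : Per (u ++ v') q) (hp : p + q ≤ u.length) : v = v' := by
  have hg := (h.left (by omega)).gcd (h'.left (by omega)) (by omega)
  rw [List.hasPeriod_iff_forall_getElem?_mod] at hg
  have hp0 := h.1
  have hq0 := h'.1
  apply eq_of_append hl
  intro i hi
  have h1 := Nat.mod_lt i hp0
  have h2 := Nat.mod_lt i hq0
  rw [h.getElem?_left (by omega) i hi, h'.getElem?_left (by omega) i (by omega),
    hg (i % p) (by omega), hg (i % q) (by omega), Nat.mod_mod_of_dvd _ (Nat.gcd_dvd_left p q),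
    Nat.mod_mod_of_dvd _ (Nat.gcd_dvd_right p q)]

/-- Classification of powers: squares, cubes, others. -/
def PCls {α : Type*} (w : List α) (a : Fin 3) : Prop :=
  (a = 0 ∧ ∃ p, w.length = 2 * p ∧ Per w p) ∨
  (a = 1 ∧ ∃ p, w.length = 3 * p ∧ Per w p) ∨
  (a = 2 ∧ ∃ p, 5 * p ≤ w.length ∧ Per w p)

theorem IsPower.cls {α : Type*} {w : List α} (h : IsPower w) : ∃ a, PCls w a := by
  obtain ⟨k, p, hk, hl, hp⟩ := h.per
  have hp0 := hp.1
  by_cases h2 : 2 ∣ k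
  · obtain ⟨j, rfl⟩ := h2
    have hj : 0 < j := by omega
    refine ⟨0, Or.inl ⟨rfl, j * p, by rw [hl]; ring, hp.mono ⟨j, by ring⟩ (by positivity) ⟨2, ?_⟩⟩⟩
    rw [hl]; ring
  by_cases h3 : 3 ∣ k
  · obtain ⟨j, rfl⟩ := h3
    have hj : 0 < j := by omega
    refine ⟨1, Or.inr (Or.inl ⟨rfl, j * p, by rw [hl]; ring,
      hp.mono ⟨j, by ring⟩ (by positivity) ⟨3, ?_⟩⟩)⟩
    rw [hl]; ring
  · refine ⟨2, Or.inr (Or.inr ⟨rfl, p, ?_, hp⟩)⟩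
    rw [hl]
    exact Nat.mul_le_mul_right _ (by omega)

theorem PCls.rot {α : Type*} {u v : List α} {a : Fin 3} (h : PCls (u ++ v) a) :
    PCls (v ++ u) a := by
  have e : (v ++ u).length = (u ++ v).length := by simp [add_comm]
  unfold PCls at *
  rw [e]
  rcases h with ⟨h, p, h1, h2⟩ | ⟨h, p, h1, h2⟩ | ⟨h, p, h1, h2⟩
  · exact Or.inl ⟨h, p, h1, h2.rot⟩
  · exact Or.inr (Or.inl ⟨h, p, h1, h2.rot⟩)
  · exact Or.inr (Or.inr ⟨h, p, h1, h2.rot⟩)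

theorem PCls.inj {α : Type*} {u v v' : List α} {a : Fin 3} (hl : v.length = v'.length)
    (hu : v.length ≤ u.length + 1) (h : PCls (u ++ v) a) (h' : PCls (u ++ v') a) : v = v' := by
  unfold PCls at h h'
  simp only [List.length_append] at h h'
  rcases h with ⟨h, p, h1, h2⟩ | ⟨h, p, h1, h2⟩ | ⟨h, p, h1, h2⟩ <;>
  rcases h' with ⟨h', q, h1', h2'⟩ | ⟨h', q, h1', h2'⟩ | ⟨h', q, h1', h2'⟩ <;>
  first
  | (exfalso; subst h; revert h'; decide)
  | skip
  · obtain rfl : p = q := by omega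
    exact row_same hl h2 h2' (by omega)
  · obtain rfl : p = q := by omega
    have := h2.1
    exact row_same hl h2 h2' (by omega)
  · have := h2.1
    have := h2'.1
    exact row_diff hl h2 h2' (by omega)

theorem PCls.sq {α : Type*} {u v : List α} (h1 : u.length ≤ v.length)
    (h2 : v.length ≤ u.length + 1) (h : PCls (u ++ v) 0) : u = v := by
  unfold PCls at h
  simp only [List.length_append] at h
  rcases h with ⟨-, p, e, h⟩ | ⟨h, -⟩ | ⟨h, -⟩
  · have hu : u.length = p := by omega
    have hv : v.length = p := by omega
    apply List.ext_getElem?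
    intro i
    by_cases hi : i < p
    · have := h.2.2 (p + i) (by rw [List.length_append]; omega)
      rw [Nat.add_mod_left, Nat.mod_eq_of_lt hi, List.getElem?_append_right (by omega),
        List.getElem?_append_left (by omega), hu, Nat.add_sub_cancel_left] at this
      exact this.symm
    · rw [List.getElem?_eq_none (by omega), List.getElem?_eq_none (by omega)]
  · exact absurd h (by decide)
  · exact absurd h (by decide)

theorem row_card {α : Type*} (u : List α) (V : Finset (List α)) (t : ℕ)
    (hV : ∀ v ∈ V, v.length = t) (ht : t ≤ u.length + 1)
    (h : ∀ v ∈ V, ∃ a, PCls (u ++ v) a) :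
    V.card ≤ 3 ∧ (V.card = 3 → ∃ v ∈ V, PCls (u ++ v) 0) := by
  classical
  choose! f hf using h
  have inj : Set.InjOn f V := by
    intro v hv v' hv' e
    have h1 := hf v hv
    rw [e] at h1
    exact PCls.inj ((hV v hv).trans (hV v' hv').symm) (by rw [hV v hv]; exact ht) h1 (hf v' hv')
  have hc := Finset.card_image_of_injOn inj
  constructor
  · rw [← hc]
    exact (Finset.card_le_univ _).trans (by simp)
  · intro h3
    have : V.image f = Finset.univ := by
      rw [← Finset.card_eq_iff_eq_univ, hc, h3]; simp
    have h0 : (0 : Fin 3) ∈ V.image f := by rw [this]; simp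
    obtain ⟨v, hv, e⟩ := Finset.mem_image.1 h0
    exact ⟨v, hv, e ▸ hf v hv⟩

theorem grid {α : Type*} (U V : Finset (List α)) (s t : ℕ) (hst : s ≤ t) (hts : t ≤ s + 1)
    (hU : ∀ u ∈ U, u.length = s) (hV : ∀ v ∈ V, v.length = t)
    (h : ∀ u ∈ U, ∀ v ∈ V, ∃ a, PCls (u ++ v) a) : U.card * V.card ≤ 7 := by
  classical
  rcases U.eq_empty_or_nonempty with rfl | ⟨u0, hu0⟩
  · simp
  rcases V.eq_empty_or_nonempty with rfl | ⟨v0, hv0⟩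
  · simp
  have hv3 := (row_card u0 V t hV (by rw [hU u0 hu0]; exact hts) (h u0 hu0)).1
  have hu3 := (row_card v0 U s hU (by rw [hV v0 hv0]; omega)
    (fun u hu => (h u hu v0 hv0).imp fun a ha => ha.rot)).1
  by_cases cu : U.card = 3
  · by_cases cv : V.card = 3
    · exfalso
      have sub : U ⊆ V := by
        intro u hu
        obtain ⟨v, hv, hc⟩ := (row_card u V t hV (by rw [hU u hu]; exact hts) (h u hu)).2 cv
        have := hc.sq (by rw [hU u hu, hV v hv]; exact hst) (by rw [hU u hu, hV v hv]; exact hts)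
        rwa [this]
      obtain ⟨x, y, z, hxy, hxz, hyz, rfl⟩ := Finset.card_eq_three.1 cu
      have mx : x ∈ ({x, y, z} : Finset (List α)) := by simp
      have my : y ∈ ({x, y, z} : Finset (List α)) := by simp
      have mz : z ∈ ({x, y, z} : Finset (List α)) := by simp
      have lx := hU x mx
      have ly := hU y my
      have lz := hU z mz
      obtain ⟨a, ha⟩ := h x mx y (sub my)
      obtain ⟨b, hb⟩ := h x mx z (sub mz)
      obtain ⟨c, hc⟩ := h y my z (sub mz)
      have a0 : a ≠ 0 := by
        rintro rfl; exact hxy (ha.sq (by omega) (by omega))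
      have b0 : b ≠ 0 := by
        rintro rfl; exact hxz (hb.sq (by omega) (by omega))
      have c0 : c ≠ 0 := by
        rintro rfl; exact hyz (hc.sq (by omega) (by omega))
      have ab : a ≠ b := by
        rintro rfl; exact hyz (PCls.inj (by omega) (by omega) ha hb)
      have ac : a ≠ c := by
        rintro rfl; exact hxz (PCls.inj (by omega) (by omega) ha.rot hc)
      have bc : b ≠ c := by
        rintro rfl; exact hxy (PCls.inj (by omega) (by omega) hb.rot hc.rot)
      omega
    · have : V.card ≤ 2 := by omega
      nlinarith
  · have : U.card ≤ 2 := by omega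
    nlinarith

/-- If every word of length ≥ ℓ accepted by an n-state NFA is a power, then for every
r ≥ ℓ the NFA accepts at most 7n words of length r. -/
theorem nfa_power_slender {α σ : Type*} [Fintype σ] (M : NFA α σ) (n : ℕ)
    (hn : Fintype.card σ = n) (ℓ : ℕ)
    (h : ∀ w ∈ M.accepts, ℓ ≤ w.length → IsPower w) :
    ∀ r : ℕ, ℓ ≤ r →
      {w | w ∈ M.accepts ∧ w.length = r}.Finite ∧
      {w | w ∈ M.accepts ∧ w.length = r}.ncard ≤ 7 * n := by
  classical
  intro r hr
  set S : Set (List α) := {w | w ∈ M.accepts ∧ w.length = r} with hS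
  have key : ∀ T : Finset (List α), (T : Set (List α)) ⊆ S → T.card ≤ 7 * n := by
    intro T hT
    have hq : ∀ w ∈ T, ∃ q : σ, q ∈ M.evalFrom M.start (w.take (r / 2)) ∧
        w.drop (r / 2) ∈ M.acceptsFrom {q} := by
      intro w hw
      have h1 := (hT hw).1
      rw [NFA.mem_accepts, ← List.take_append_drop (r / 2) w, NFA.evalFrom_append] at h1
      obtain ⟨f, hf, h1⟩ := h1
      obtain ⟨q, hq, h2⟩ := NFA.mem_evalFrom_iff_exists.1 h1
      exact ⟨q, hq, NFA.mem_acceptsFrom.2 ⟨f, hf, h2⟩⟩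
    by_contra hcon
    have hTne : T.Nonempty := by
      rw [← Finset.card_pos]; omega
    obtain ⟨w0, hw0⟩ := hTne
    haveI : Nonempty σ := ⟨(hq w0 hw0).choose⟩
    choose! q hq1 hq2 using hq
    obtain ⟨s, -, hs⟩ := Finset.exists_lt_card_fiber_of_mul_lt_card_of_maps_to
      (s := T) (t := (Finset.univ : Finset σ)) (f := q) (n := 7) (by simp)
      (by rw [Finset.card_univ, hn]; omega)
    set F := T.filter (fun w => q w = s) with hF
    have hFS : ∀ w ∈ F, w ∈ T ∧ q w = s := fun w hw => Finset.mem_filter.1 hw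
    have hlen : ∀ w ∈ F, w.length = r := fun w hw => (hT (hFS w hw).1).2
    have hg := grid (F.image (List.take (r / 2))) (F.image (List.drop (r / 2)))
      (r / 2) (r - r / 2) (by omega) (by omega)
      (by
        intro u hu
        obtain ⟨w, hw, rfl⟩ := Finset.mem_image.1 hu
        rw [List.length_take, hlen w hw]; omega)
      (by
        intro u hu
        obtain ⟨w, hw, rfl⟩ := Finset.mem_image.1 hu
        rw [List.length_drop, hlen w hw])
      (by
        intro u hu v hv
        obtain ⟨w, hw, rfl⟩ := Finset.mem_image.1 hu
        obtain ⟨w', hw', rfl⟩ := Finset.mem_image.1 hv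
        apply IsPower.cls
        apply h
        · rw [NFA.mem_accepts, NFA.evalFrom_append]
          have h1 := hq1 w (hFS w hw).1
          have h2 := hq2 w' (hFS w' hw').1
          rw [(hFS w hw).2] at h1
          rw [(hFS w' hw').2] at h2
          obtain ⟨f, hf, h3⟩ := NFA.mem_acceptsFrom.1 h2
          exact ⟨f, hf, NFA.mem_evalFrom_iff_exists.2 ⟨s, h1, h3⟩⟩
        · rw [List.length_append, List.length_take, List.length_drop, hlen w hw, hlen w' hw']
          omega)
    have hle : F.card ≤ (F.image (List.take (r / 2)) ×ˢ F.image (List.drop (r / 2))).card := by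
      apply Finset.card_le_card_of_injOn (fun w => (w.take (r / 2), w.drop (r / 2)))
      · intro w hw
        exact Finset.mem_coe.2 (Finset.mem_product.2
          ⟨Finset.mem_image_of_mem _ hw, Finset.mem_image_of_mem _ hw⟩)
      · intro w _ w' _ e
        simp only [Prod.mk.injEq] at e
        rw [← List.take_append_drop (r / 2) w, e.1, e.2, List.take_append_drop]
    rw [Finset.card_product] at hle
    omega
  have fin : S.Finite := by
    by_contra hinf
    obtain ⟨T, hT, hc⟩ := Set.Infinite.exists_subset_card_eq hinf (7 * n + 1)
    have := key T hT
    omega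
  refine ⟨fin, ?_⟩
  rw [Set.ncard_eq_toFinset_card S fin]
  exact key _ (by simp)
end

section
/- Let M be an NFA with n states. If the language L(M) accepted by M contains a power, then there exists an integer k with 2 ≤ k ≤ n + 1 such that L(M) contains a k-power. -/
theorem listPow_succ_right {α : Type*} (x : List α) (m : ℕ) :
    listPow x (m + 1) = listPow x m ++ x := by
  simp [listPow, List.replicate_succ']

theorem mem_evalFrom_listPow {α σ : Type*} (M : NFA α σ) (S : Set σ) (x : List α) (k : ℕ) (t : σ) :
    t ∈ M.evalFrom S (listPow x k) ↔
      ∃ f : ℕ → σ, f 0 ∈ S ∧ f k = t ∧ ∀ i < k, f (i + 1) ∈ M.evalFrom {f i} x := by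
  induction k generalizing t with
  | zero =>
    constructor
    · intro h
      exact ⟨fun _ => t, by simpa [listPow] using h, rfl, by simp⟩
    · rintro ⟨f, h0, rfl, -⟩
      simpa [listPow] using h0
  | succ k ih =>
    rw [listPow_succ_right, NFA.evalFrom_append, NFA.mem_evalFrom_iff_exists]
    constructor
    · rintro ⟨s, hs, hst⟩
      obtain ⟨f, h0, rfl, hf⟩ := (ih s).1 hs
      refine ⟨fun m => if m ≤ k then f m else t, by simpa using h0, by simp, ?_⟩
      intro i hi
      rcases Nat.lt_succ_iff_lt_or_eq.1 hi with h | rfl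
      · have h1 : i + 1 ≤ k := h
        have h2 : i ≤ k := by omega
        simpa only [h1, h2, if_true] using hf i h
      · simpa using hst
    · rintro ⟨f, h0, rfl, hf⟩
      exact ⟨f k, (ih _).2 ⟨f, h0, rfl, fun i hi => hf i (by omega)⟩, hf k (by omega)⟩

/-- If an n-state NFA accepts a power, it accepts a k-power for some 2 ≤ k ≤ n + 1. -/
theorem nfa_accepts_small_exponent_power {α σ : Type*} [Fintype σ] (M : NFA α σ) (n : ℕ)
    (hn : Fintype.card σ = n)
    (h : ∃ w ∈ M.accepts, IsPower w) :
    ∃ k : ℕ, 2 ≤ k ∧ k ≤ n + 1 ∧ ∃ w ∈ M.accepts, IsKPower k w := by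
  classical
  obtain ⟨w, hw, k0, hk0, x, hx, rfl⟩ := h
  have hex : ∃ k, 2 ≤ k ∧ listPow x k ∈ M.accepts := ⟨k0, hk0, hw⟩
  obtain ⟨hk, hacc⟩ := Nat.find_spec hex
  have hmin := fun m => Nat.find_min hex (m := m)
  generalize Nat.find hex = k at hk hacc hmin
  refine ⟨k, hk, ?_, _, hacc, x, hx, rfl⟩
  by_contra hlt
  obtain ⟨t, ht, htk⟩ := hacc
  obtain ⟨f, h0, rfl, hf⟩ := (mem_evalFrom_listPow M _ x k t).1 htk
  have key : ∃ i j : ℕ, i < j ∧ j ≤ n ∧ f i = f j := by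
    obtain ⟨a, b, hab, he⟩ := Fintype.exists_ne_map_eq_of_card_lt
      (fun i : Fin (n + 1) => f i) (by simp [hn])
    rcases lt_or_gt_of_ne hab with h | h
    · exact ⟨a, b, h, by omega, he⟩
    · exact ⟨b, a, h, by omega, he.symm⟩
  obtain ⟨i, j, hij, hj, he⟩ := key
  refine hmin (k - (j - i)) (by omega) ⟨by omega, f k, ht, ?_⟩
  refine (mem_evalFrom_listPow M _ x _ _).2
    ⟨fun m => if m ≤ i then f m else f (m + (j - i)), by simpa using h0, ?_, ?_⟩
  · have h1 : ¬ (k - (j - i) ≤ i) := by omega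
    have h2 : k - (j - i) + (j - i) = k := by omega
    simp only [h1, if_false, h2]
  · intro m hm
    rcases lt_trichotomy m i with h | rfl | h
    · have h1 : m + 1 ≤ i := h
      have h2 : m ≤ i := by omega
      simpa only [h1, h2, if_true] using hf m (by omega)
    · have h1 : m + 1 + (j - m) = j + 1 := by omega
      have h2 : ¬ (m + 1 ≤ m) := by omega
      simpa only [h1, h2, le_refl, if_true, if_false, he] using hf j (by omega)
    · have h1 : ¬ (m + 1 ≤ i) := by omega
      have h2 : ¬ (m ≤ i) := by omega
      have h3 : m + 1 + (j - i) = m + (j - i) + 1 := by omega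
      simpa only [h1, h2, h3, if_false] using hf (m + (j - i)) (by omega)
end

section
/- If L ⊆ Σ* is a slender regular language, then for every integer k ≥ 2 the language L ∩ P(k, Σ) is regular, where P(k, Σ) denotes the set of all k-powers over Σ. -/
theorem listPow_zero' {α : Type*} (x : List α) : listPow x 0 = [] := by simp [listPow]

theorem listPow_add' {α : Type*} (x : List α) (m n : ℕ) :
    listPow x (m + n) = listPow x m ++ listPow x n := by
  simp only [listPow, List.replicate_add, List.flatten_append]

theorem listPow_mul' {α : Type*} (x : List α) (m n : ℕ) :
    listPow x (m * n) = listPow (listPow x m) n := by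
  induction n with
  | zero => simp [listPow_zero']
  | succ n ih => rw [Nat.mul_succ, Nat.add_comm, listPow_add', ih, listPow_succ']

/-- Commuting words are powers of a common word. -/
theorem comm_words_aux {α : Type*} (N : ℕ) : ∀ p q : List α, p.length + q.length ≤ N →
    p ++ q = q ++ p → ∃ (z : List α) (i j : ℕ), p = listPow z i ∧ q = listPow z j := by
  induction N with
  | zero =>
    intro p q h _
    refine ⟨[], 0, 0, ?_, ?_⟩ <;> rw [listPow_zero', ← List.length_eq_zero_iff] <;> omega
  | succ N ih =>
    have key : ∀ p q : List α, p.length + q.length ≤ N + 1 → p.length ≤ q.length →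
      p ++ q = q ++ p → ∃ (z : List α) (i j : ℕ), p = listPow z i ∧ q = listPow z j := by
      intro p q h hle hc
      by_cases hp : p = []
      · exact ⟨q, 0, 1, by simp [hp, listPow_zero'], by simp [listPow]⟩
      · have hpre : p <+: q :=
          List.prefix_of_prefix_length_le ⟨q, rfl⟩ ⟨p, hc.symm⟩ hle
        obtain ⟨r, rfl⟩ := hpre
        have hpl := List.length_pos_iff.2 hp
        rw [List.length_append] at h
        obtain ⟨z, i, j, h1, h2⟩ := ih p r (by omega) (by simpa using hc)
        refine ⟨z, i, i + j, h1, ?_⟩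
        rw [listPow_add', ← h1, ← h2]
    intro p q h hc
    rcases le_total p.length q.length with hle | hle
    · exact key p q h hle hc
    · obtain ⟨z, i, j, h1, h2⟩ := key q p (by omega) hle hc.symm
      exact ⟨z, j, i, h2, h1⟩

theorem root_of_rotate {α : Type*} (y : List α) (P : ℕ) (h0 : 0 < P) (hP : P < y.length)
    (h : y.rotate P = y) : ∃ (z : List α) (m : ℕ), y = listPow z m ∧ z.length < y.length := by
  rw [List.rotate_eq_drop_append_take hP.le] at h
  obtain ⟨z, i, j, h1, h2⟩ := comm_words_aux _ (y.take P) (y.drop P) le_rfl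
    (by rw [h, List.take_append_drop])
  have hy : y = listPow z (i + j) := by
    rw [listPow_add', ← h1, ← h2, List.take_append_drop]
  have l1 := congrArg List.length h1
  have l2 := congrArg List.length h2
  rw [length_listPow', List.length_take] at l1
  rw [length_listPow', List.length_drop] at l2
  have hi : 0 < i := Nat.pos_of_ne_zero (by rintro rfl; omega)
  have hz : z.length ≤ i * z.length := Nat.le_mul_of_pos_left _ hi
  exact ⟨z, i + j, hy, by omega⟩

/-- The combinatorial heart. -/
theorem window_rotate {α : Type*} (y A e D V V' : List α) (h : y ++ y = A ++ e ++ D)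
    (hV : e ++ V' = V ++ e) (hA : A.length ≤ y.length)
    (hlen : y.length + V.length ≤ e.length) (hVy : V.length ≤ y.length) :
    y.rotate V.length = y := by
  obtain ⟨R, rfl⟩ : A <+: y :=
    List.prefix_of_prefix_length_le (l₃ := y ++ y) ⟨e ++ D, by simp [h]⟩ ⟨y, rfl⟩ hA
  have h1 : (R ++ A) ++ R = e ++ D := by
    have : A ++ ((R ++ A) ++ R) = A ++ (e ++ D) := by simpa using h
    exact List.append_cancel_left this
  have hpe : (R ++ A) <+: e :=
    List.prefix_of_prefix_length_le (l₃ := e ++ D) ⟨R, h1⟩ ⟨D, rfl⟩ (by simp at hlen ⊢; omega)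
  obtain ⟨F, rfl⟩ := hpe
  have hR : R = F ++ D := by
    rw [List.append_assoc (R ++ A)] at h1
    exact List.append_cancel_left h1
  have hVF : V.length ≤ F.length := by simp at hlen; omega
  have hVu : V <+: R ++ A := by
    refine List.prefix_of_prefix_length_le (l₃ := R ++ A ++ F ++ V') ?_ ?_ ?_
    · rw [hV]; exact ⟨_, rfl⟩
    · exact ⟨F ++ V', by simp⟩
    · simp at hVy ⊢; omega
  obtain ⟨q, hq⟩ := hVu
  have hVFp : V <+: F := by
    refine List.prefix_of_prefix_length_le (l₃ := R ++ A) ⟨q, hq⟩ ⟨D ++ A, ?_⟩ hVF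
    rw [hR]; simp
  obtain ⟨G, rfl⟩ := hVFp
  rw [← hq] at hV
  have h2 : (q ++ V) ++ (G ++ V') = (V ++ q) ++ (V ++ G) := by
    have : V ++ ((q ++ V) ++ (G ++ V')) = V ++ ((V ++ q) ++ (V ++ G)) := by simpa using hV
    exact List.append_cancel_left this
  have h3 : q ++ V = V ++ q := (List.append_inj h2 (by simp; omega)).1
  have h4 : (A ++ R).rotate A.length = R ++ A := List.rotate_append_length_eq _ _
  have h5 : (R ++ A).rotate V.length = R ++ A := by
    rw [← hq, List.rotate_append_length_eq, h3]
  rw [← h4, List.rotate_rotate, Nat.add_comm, ← List.rotate_rotate] at h5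
  exact List.rotate_injective _ h5

theorem evalFrom_listPow {α σ : Type*} (M : DFA α σ) (q : σ) (v : List α)
    (h : M.evalFrom q v = q) (m : ℕ) : M.evalFrom q (listPow v m) = q := by
  induction m with
  | zero => simp [listPow_zero']
  | succ m ih => rw [listPow_succ', DFA.evalFrom_of_append, h, ih]

theorem slender_root_step {α σ : Type*} [Fintype σ] (M : DFA α σ) (C : ℕ)
    (hC : ∀ r : ℕ, {w | w ∈ M.accepts ∧ w.length = r}.Finite ∧
      {w | w ∈ M.accepts ∧ w.length = r}.ncard < C) (y : List α) (m : ℕ) (hm : 2 ≤ m)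
    (hy : listPow y m ∈ M.accepts)
    (hB : C * (Fintype.card σ * Fintype.card σ) + 2 * Fintype.card σ < y.length) :
    ∃ (z : List α) (m : ℕ), y = listPow z m ∧ z.length < y.length := by
  set n := Fintype.card σ with hn
  obtain ⟨m, rfl⟩ := Nat.exists_eq_add_of_le hm
  obtain ⟨q, a, v, b, hyab, hlen, hv, hqa, hqv, hqb⟩ :=
    M.evalFrom_split (x := y) (s := M.start) (t := M.evalFrom M.start y) (by omega) rfl
  obtain ⟨q', a', v', b', hyab', hlen', hv', hqa', hqv', hqb'⟩ :=
    M.evalFrom_split (x := y.drop (y.length - n))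
      (s := M.evalFrom M.start (y ++ y.take (y.length - n)))
      (t := M.evalFrom M.start (y ++ y)) (by simp; omega)
      (by rw [← DFA.evalFrom_of_append, List.append_assoc, List.take_append_drop])
  set c := y.take (y.length - n) with hc
  have hyc : y = c ++ a' ++ v' ++ b' := by
    rw [← List.take_append_drop (y.length - n) y, hyab']; simp [hc]
  have hlast : (a' ++ v' ++ b').length = n := by rw [← hyab']; simp; omega
  set e := b ++ c ++ a' with he
  have hyy : y ++ y = (a ++ v) ++ e ++ (v' ++ b') := by
    conv_lhs => rw [hyab]
    rw [he]
    conv_lhs => rw [← hyab, hyc]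
    rw [← hyc]
    conv_lhs => lhs; rw [hyab]
    conv_lhs => rhs; rw [hyc]
    simp
  have hqe : M.evalFrom q e = q' := by
    rw [← hqa', hyab]
    simp only [he, DFA.evalFrom_of_append, hqa, hqv]
  have hfin : M.evalFrom q' (b' ++ listPow y m) ∈ M.accept := by
    rw [DFA.evalFrom_of_append, hqb', ← DFA.evalFrom_of_append]
    rw [listPow_add'] at hy
    simpa [listPow, DFA.mem_accepts, DFA.eval, List.replicate_succ] using hy
  let W : ℕ → List α := fun s => a ++ (listPow v (s * v'.length) ++ e ++
    listPow v' ((C - s) * v.length)) ++ (b' ++ listPow y m)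
  have hW : ∀ s, W s ∈ M.accepts := by
    intro s
    rw [DFA.mem_accepts, DFA.eval]
    simp only [W]
    rw [DFA.evalFrom_of_append] at hfin
    simp only [DFA.evalFrom_of_append, hqa, evalFrom_listPow M q v hqv, hqe,
      evalFrom_listPow M q' v' hqv']
    exact hfin
  have hWl : ∀ s ≤ C, (W s).length = a.length + e.length + C * v.length * v'.length +
      (b' ++ listPow y m).length := by
    intro s hs
    obtain ⟨d, rfl⟩ := Nat.exists_eq_add_of_le hs
    simp only [W, List.length_append, length_listPow', Nat.add_sub_cancel_left]
    ring
  obtain ⟨hf, hcard⟩ := hC (a.length + e.length + C * v.length * v'.length +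
      (b' ++ listPow y m).length)
  obtain ⟨s, hs, s', hs', hne, heq⟩ : ∃ s ∈ Finset.range C, ∃ s' ∈ Finset.range C,
      s ≠ s' ∧ W s = W s' := by
    apply Finset.exists_ne_map_eq_of_card_lt_of_maps_to (t := hf.toFinset)
    · rw [Finset.card_range, ← Set.ncard_eq_toFinset_card _ hf]; exact hcard
    · intro s hs
      have hs : s < C := by simpa using hs
      simp only [Set.Finite.coe_toFinset, Set.mem_ofPred_eq]
      exact ⟨hW s, hWl s hs.le⟩
  rw [Finset.mem_range] at hs hs'
  wlog hlt : s < s' generalizing s s'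
  · exact this s' hs' s hs hne.symm heq.symm (by omega)
  obtain ⟨d, rfl⟩ := Nat.exists_eq_add_of_lt hlt
  have hCs : C - s = (d + 1) + (C - (s + d + 1)) := by omega
  have heq' : e ++ listPow v' ((d + 1) * v.length) = listPow v ((d + 1) * v'.length) ++ e := by
    simp only [W] at heq
    have h1 := List.append_cancel_left (List.append_cancel_right heq)
    rw [hCs, add_mul (d + 1), listPow_add', Nat.add_assoc s d 1, add_mul s, listPow_add' v,
      ← List.append_assoc] at h1
    have h2 := List.append_cancel_right h1
    rw [List.append_assoc (listPow v _) e, List.append_assoc (listPow v _) (listPow v _)] at h2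
    exact List.append_cancel_left h2
  have hvl := List.length_pos_iff.2 hv
  have hvl' := List.length_pos_iff.2 hv'
  have hVlen : (listPow v ((d + 1) * v'.length)).length ≤ C * (n * n) := by
    rw [length_listPow', Nat.mul_assoc]
    exact Nat.mul_le_mul (by omega) (Nat.mul_le_mul (by omega) (by omega))
  have hVpos : 0 < (listPow v ((d + 1) * v'.length)).length := by
    rw [length_listPow']; positivity
  have hll := congrArg List.length hyy
  simp only [List.length_append] at hll hlast
  refine root_of_rotate y _ hVpos (by omega)
    (window_rotate y (a ++ v) e (v' ++ b') _ _ hyy heq' ?_ ?_ ?_)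
  · simp only [List.length_append]; omega
  · omega
  · omega

theorem slender_root {α σ : Type*} [Fintype σ] (M : DFA α σ) (C : ℕ)
    (hC : ∀ r : ℕ, {w | w ∈ M.accepts ∧ w.length = r}.Finite ∧
      {w | w ∈ M.accepts ∧ w.length = r}.ncard < C) (N : ℕ) :
    ∀ (y : List α) (m : ℕ), y.length ≤ N → 2 ≤ m → y ≠ [] → listPow y m ∈ M.accepts →
    ∃ (z : List α) (j : ℕ), z ≠ [] ∧ 0 < j ∧ y = listPow z j ∧
      z.length ≤ C * (Fintype.card σ * Fintype.card σ) + 2 * Fintype.card σ := by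
  induction N with
  | zero => intro y m h _ hy; exact absurd (List.length_eq_zero_iff.1 (by omega)) hy
  | succ N ih =>
    intro y m hN hm hy hacc
    by_cases hB : C * (Fintype.card σ * Fintype.card σ) + 2 * Fintype.card σ < y.length
    · obtain ⟨z, j, hz, hlt⟩ := slender_root_step M C hC y m hm hacc hB
      have hz0 : z ≠ [] := by
        rintro rfl
        exact hy (by rw [hz]; simp [listPow])
      have hj : 0 < j := Nat.pos_of_ne_zero (by
        rintro rfl
        exact hy (by rw [hz]; simp [listPow]))
      obtain ⟨t, i, ht, hi, hzt, hl⟩ := ih z (j * m) (by omega)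
        (le_trans hm (Nat.le_mul_of_pos_left _ hj)) hz0 (by rw [listPow_mul', ← hz]; exact hacc)
      exact ⟨t, i * j, ht, by positivity, by rw [listPow_mul', ← hzt, hz], hl⟩
    · exact ⟨y, 1, hy, one_pos, by simp [listPow], by omega⟩

theorem powers_regular {α : Type*} (x : List α) (hx : x ≠ []) :
    Language.IsRegular ({w | ∃ m : ℕ, 0 < m ∧ w = listPow x m} : Language α) := by
  set S : Language α := {w | ∃ m : ℕ, 0 < m ∧ w = listPow x m} with hS
  have hmem : ∀ w, w ∈ S ↔ ∃ m : ℕ, 0 < m ∧ w = listPow x m := fun w => Iff.rfl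
  have key : ∀ (N : ℕ) (u : List α), u.length ≤ N → S.leftQuotient u = (∅ : Set (List α)) ∨
      ∃ i ∈ Set.Iic x.length, S.leftQuotient (x.take i) = S.leftQuotient u := by
    intro N
    induction N with
    | zero =>
      intro u hu
      refine Or.inr ⟨0, by simp, ?_⟩
      rw [List.length_eq_zero_iff.1 (Nat.le_zero.1 hu)]; simp
    | succ N ih =>
      intro u hu
      by_cases hne : S.leftQuotient u = (∅ : Set (List α))
      · exact Or.inl hne
      obtain ⟨z, hz⟩ := Set.nonempty_iff_ne_empty.2 hne
      obtain ⟨m, hm, hz⟩ : ∃ m : ℕ, 0 < m ∧ u ++ z = listPow x m := hz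
      obtain ⟨m, rfl⟩ := Nat.exists_eq_add_of_lt hm
      rw [Nat.zero_add, listPow_succ'] at hz
      rcases le_or_gt u.length x.length with hle | hlt
      · refine Or.inr ⟨u.length, hle, ?_⟩
        have hp : u <+: x := List.prefix_of_prefix_length_le ⟨z, hz⟩ ⟨_, rfl⟩ hle
        rw [← List.prefix_iff_eq_take.1 hp]
      · have hp : x <+: u := List.prefix_of_prefix_length_le ⟨_, rfl⟩ ⟨z, hz⟩ hlt.le
        obtain ⟨u', rfl⟩ := hp
        have hxl := List.length_pos_iff.2 hx
        rw [List.length_append] at hu hlt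
        have hq : S.leftQuotient (x ++ u') = S.leftQuotient u' := by
          ext t
          rw [Language.mem_leftQuotient, Language.mem_leftQuotient, hmem, hmem]
          constructor
          · rintro ⟨j, hj, h⟩
            obtain ⟨j, rfl⟩ := Nat.exists_eq_add_of_lt hj
            rw [Nat.zero_add, listPow_succ', List.append_assoc] at h
            have h := List.append_cancel_left h
            refine ⟨j, Nat.pos_of_ne_zero ?_, h⟩
            rintro rfl
            have := congrArg List.length h
            simp [listPow] at this
            simp [this] at hlt
          · rintro ⟨j, hj, h⟩
            exact ⟨j + 1, by omega, by rw [listPow_succ', ← h, List.append_assoc]⟩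
        rw [hq]
        exact ih u' (by omega)
  apply Language.IsRegular.of_finite_range_leftQuotient
  refine Set.Finite.subset (((Set.finite_Iic x.length).image
    (fun i => S.leftQuotient (x.take i))).insert (∅ : Set (List α))) ?_
  rintro _ ⟨u, rfl⟩
  rcases key _ u le_rfl with h | ⟨i, hi, h⟩
  · exact Or.inl h
  · exact Or.inr ⟨i, hi, h⟩

theorem regular_of_iff {α : Type*} {L L' : Language α} (h : L.IsRegular)
    (hL : ∀ w, w ∈ L' ↔ w ∈ L) : L'.IsRegular := by
  have : L' = L := Set.ext hL
  rwa [this]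

theorem empty_regular {α : Type*} : Language.IsRegular ((∅ : Set (List α)) : Language α) := by
  apply Language.IsRegular.of_finite_range_leftQuotient
  refine (Set.finite_singleton ((∅ : Set (List α)) : Language α)).subset ?_
  rintro _ ⟨u, rfl⟩
  rfl

theorem union_regular {α : Type*} (k : ℕ) (hk : 2 ≤ k) (F : Set (List α)) (hF : F.Finite)
    (h0 : ∀ y ∈ F, y ≠ []) :
    Language.IsRegular ({w | ∃ y ∈ F, ∃ m : ℕ, 0 < m ∧ w = listPow (listPow y k) m} :
      Language α) := by
  induction F, hF using Set.Finite.induction_on with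
  | empty =>
    refine regular_of_iff (empty_regular (α := α)) fun w => ?_
    constructor
    · rintro ⟨y, hy, _⟩
      exact hy
    · intro h
      exact absurd h (Set.notMem_empty w)
  | @insert y F _ _ ih =>
    have hyk : listPow y k ≠ [] := by
      rw [← List.length_pos_iff, length_listPow']
      have := List.length_pos_iff.2 (h0 y (Set.mem_insert _ _))
      positivity
    have := (powers_regular _ hyk).add (ih fun z hz => h0 z (Set.mem_insert_of_mem _ hz))
    refine regular_of_iff (this) fun w => ?_
    constructor
    · rintro ⟨z, rfl | hz, h⟩
      · exact Or.inl h
      · exact Or.inr ⟨z, hz, h⟩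
    · rintro (h | ⟨z, hz, h⟩)
      · exact ⟨y, Or.inl rfl, h⟩
      · exact ⟨z, Or.inr hz, h⟩

theorem prefixes_finite {α σ : Type*} [Fintype σ] (M : DFA α σ)
    (hC : ∀ r : ℕ, {w | w ∈ M.accepts ∧ w.length = r}.Finite) (B : ℕ) :
    {y : List α | y ≠ [] ∧ y.length ≤ B ∧ ∃ t, y ++ t ∈ M.accepts}.Finite := by
  classical
  have hz : ∀ q : σ, ∃ z : List α, (∃ t, M.evalFrom q t ∈ M.accept) →
      M.evalFrom q z ∈ M.accept := by
    intro q
    by_cases h : ∃ t, M.evalFrom q t ∈ M.accept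
    · obtain ⟨t, ht⟩ := h
      exact ⟨t, fun _ => ht⟩
    · exact ⟨[], fun h' => absurd h' h⟩
  choose z hz using hz
  have hfin : (⋃ q : σ, ⋃ b ∈ Set.Iic B, (fun y : List α => y ++ z q) ⁻¹'
      {w | w ∈ M.accepts ∧ w.length = b + (z q).length}).Finite := by
    refine Set.finite_iUnion fun q => (Set.finite_Iic B).biUnion fun b _ => ?_
    exact (hC _).preimage (fun a _ b _ h => List.append_cancel_right h)
  refine hfin.subset ?_
  rintro y ⟨_, hyB, t, ht⟩
  simp only [Set.mem_iUnion]
  refine ⟨M.evalFrom M.start y, y.length, hyB, ?_, by simp⟩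
  rw [DFA.mem_accepts, DFA.eval, DFA.evalFrom_of_append]
  apply hz
  refine ⟨t, ?_⟩
  rwa [← DFA.evalFrom_of_append]

/-- If L is a slender regular language, then the set of k-powers in L is regular. -/
theorem slender_regular_inter_kpowers_regular {α : Type*} (L : Language α)
    (hreg : L.IsRegular) (hslender : Slender L) (k : ℕ) (hk : 2 ≤ k) :
    Language.IsRegular ({w | w ∈ L ∧ IsKPower k w} : Language α) := by
  have hreg0 := hreg
  obtain ⟨σ, _, M, rfl⟩ := hreg
  obtain ⟨C, hC⟩ := hslender
  set B := C * (Fintype.card σ * Fintype.card σ) + 2 * Fintype.card σ with hB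
  have hfin := prefixes_finite M (fun r => (hC r).1) B
  have hU := union_regular k hk _ hfin (fun y hy => hy.1)
  refine regular_of_iff (hreg0.inf hU) fun w => ?_
  constructor
  · rintro ⟨hw, x, hx, rfl⟩
    refine ⟨hw, ?_⟩
    obtain ⟨y, j, hy, hj, rfl, hl⟩ := slender_root M C hC _ x k le_rfl hk hx hw
    refine ⟨y, ⟨hy, hl, ?_⟩, j, hj, ?_⟩
    · rw [← listPow_mul'] at hw
      have : 0 < j * k := by positivity
      obtain ⟨i, hi⟩ := Nat.exists_eq_add_of_lt this
      rw [hi, Nat.zero_add, listPow_succ'] at hw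
      exact ⟨_, hw⟩
    · rw [← listPow_mul', ← listPow_mul', Nat.mul_comm]
  · rintro ⟨hw, y, ⟨hy, _, _⟩, m, hm, rfl⟩
    refine ⟨hw, listPow y m, ?_, ?_⟩
    · rw [← List.length_pos_iff, length_listPow']
      have := List.length_pos_iff.2 hy
      positivity
    · rw [← listPow_mul', ← listPow_mul', Nat.mul_comm]
end

section
/- Let M be an NFA with n states. If the language L(M) accepted by M contains at least one bordered word, then L(M) contains a bordered word of length at most 2n² + n − 1. -/
theorem short_path {α τ : Type*} [Fintype τ] (M : NFA α τ) (p q : τ) (x : List α)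
    (h : q ∈ M.evalFrom {p} x) :
    ∃ y, q ∈ M.evalFrom {p} y ∧ y.length < Fintype.card τ := by
  induction hk : x.length using Nat.strong_induction_on generalizing x with
  | _ k ih =>
  by_cases hc : x.length < Fintype.card τ
  · exact ⟨x, h, hc⟩
  have hg : ∀ i : ℕ, ∃ t, t ∈ M.evalFrom {p} (x.take i) ∧ q ∈ M.evalFrom {t} (x.drop i) := by
    intro i
    rw [← List.take_append_drop i x, NFA.evalFrom_append, NFA.mem_evalFrom_iff_exists] at h
    exact h
  choose g hg1 hg2 using hg
  obtain ⟨i, j, hij, hgij⟩ := Fintype.exists_ne_map_eq_of_card_lt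
    (fun i : Fin (x.length + 1) => g i) (by simp; omega)
  have main : ∀ i j : Fin (x.length + 1), i < j → g i = g j →
      ∃ y, q ∈ M.evalFrom {p} y ∧ y.length < Fintype.card τ := by
    intro i j hlt he
    refine ih (x.take i ++ x.drop j).length ?_ (x.take i ++ x.drop j) ?_ rfl
    · have := j.2
      have h2 : (i : ℕ) < j := hlt
      simp only [List.length_append, List.length_take, List.length_drop]
      omega
    · rw [NFA.evalFrom_append, NFA.mem_evalFrom_iff_exists]
      exact ⟨g i, hg1 i, he ▸ hg2 j⟩
  rcases lt_or_gt_of_ne hij with hlt | hlt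
  · exact main i j hlt hgij
  · exact main j i hlt hgij.symm

theorem short_path' {α τ : Type*} [Fintype τ] (M : NFA α τ) (p q : τ) (x : List α) (hx : x ≠ [])
    (h : q ∈ M.evalFrom {p} x) :
    ∃ y, y ≠ [] ∧ q ∈ M.evalFrom {p} y ∧ y.length ≤ Fintype.card τ := by
  cases x with
  | nil => exact absurd rfl hx
  | cons a x =>
    rw [NFA.evalFrom_cons, NFA.mem_evalFrom_iff_exists] at h
    obtain ⟨t, ht, h⟩ := h
    obtain ⟨y, hy, hl⟩ := short_path M t q x h
    refine ⟨a :: y, by simp, ?_, by simpa using hl⟩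
    rw [NFA.evalFrom_cons, NFA.mem_evalFrom_iff_exists]
    exact ⟨t, ht, hy⟩

/-- The square of an automaton (transitions only). -/
def sqNFA {α σ : Type*} (M : NFA α σ) : NFA α (σ × σ) :=
  NFA.mk (fun s a => M.step s.1 a ×ˢ M.step s.2 a) ∅ ∅

theorem sqNFA_eval {α σ : Type*} (M : NFA α σ) (x : List α) (S T : Set σ) :
    (sqNFA M).evalFrom (S ×ˢ T) x = M.evalFrom S x ×ˢ M.evalFrom T x := by
  induction x generalizing S T with
  | nil => rfl
  | cons a x ih =>
    have : (sqNFA M).stepSet (S ×ˢ T) a = M.stepSet S a ×ˢ M.stepSet T a := by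
      ext ⟨s, t⟩
      simp only [NFA.mem_stepSet, Set.mem_prod, sqNFA, Prod.exists]
      constructor
      · rintro ⟨c, d, ⟨hc, hd⟩, h1, h2⟩
        exact ⟨⟨c, hc, h1⟩, ⟨d, hd, h2⟩⟩
      · rintro ⟨⟨c, hc, h1⟩, ⟨d, hd, h2⟩⟩
        exact ⟨c, d, ⟨hc, hd⟩, h1, h2⟩
    rw [NFA.evalFrom_cons, this, ih]; rfl

/-- If an n-state NFA accepts at least one bordered word, it accepts a bordered word of
length at most 2n² + n - 1. -/
theorem nfa_accepts_short_bordered {α σ : Type*} [Fintype σ] (M : NFA α σ) (n : ℕ)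
    (hn : Fintype.card σ = n)
    (h : ∃ w ∈ M.accepts, Bordered w) :
    ∃ w ∈ M.accepts, Bordered w ∧ w.length ≤ 2 * n ^ 2 + n - 1 := by
  obtain ⟨_, ⟨f, hf, hw⟩, u, w, hu, rfl⟩ := h
  change f ∈ M.evalFrom M.start _ at hw
  rw [NFA.evalFrom_append, NFA.evalFrom_append, NFA.mem_evalFrom_iff_exists] at hw
  obtain ⟨q, hq, hqf⟩ := hw
  rw [NFA.mem_evalFrom_iff_exists] at hq
  obtain ⟨p, hp, hpq⟩ := hq
  rw [NFA.mem_evalFrom_iff_exists] at hp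
  obtain ⟨s, hs, hsp⟩ := hp
  obtain ⟨w', hw', hl⟩ := short_path M p q w hpq
  have key : ∀ y, (p, f) ∈ (sqNFA M).evalFrom {(s, q)} y ↔
      p ∈ M.evalFrom {s} y ∧ f ∈ M.evalFrom {q} y := by
    intro y
    rw [← Set.singleton_prod_singleton, sqNFA_eval, Set.mem_prod]
  obtain ⟨u', hu', hpf, hl'⟩ := short_path' (sqNFA M) (s, q) (p, f) u hu ((key u).2 ⟨hsp, hqf⟩)
  obtain ⟨h1, h2⟩ := (key u').1 hpf
  refine ⟨u' ++ w' ++ u', ⟨f, hf, ?_⟩, ⟨u', w', hu', rfl⟩, ?_⟩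
  · change f ∈ M.evalFrom M.start _
    rw [NFA.evalFrom_append, NFA.evalFrom_append, NFA.mem_evalFrom_iff_exists]
    refine ⟨q, ?_, h2⟩
    rw [NFA.mem_evalFrom_iff_exists]
    refine ⟨p, ?_, hw'⟩
    rw [NFA.mem_evalFrom_iff_exists]
    exact ⟨s, hs, h1⟩
  · rw [Fintype.card_prod, hn, ← pow_two] at hl'
    rw [hn] at hl
    simp only [List.length_append]
    omega
end

section
/- Let L be a regular language over Σ such that every word in L is bordered. Then L can be written as a finite union of languages of the form J·K·J, where each J and K is a regular language and the empty word does not belong to J. -/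
/-- The automaton tracking the transformation of a word and whether it is non-empty. -/
def transDFA {α σ : Type*} (M : DFA α σ) (A : Set (Bool × (σ → σ))) : DFA α (Bool × (σ → σ)) where
  step p a := (true, fun s => M.step (p.2 s) a)
  start := (false, id)
  accept := A

theorem transDFA_eval {α σ : Type*} (M : DFA α σ) (A : Set (Bool × (σ → σ))) (x : List α) :
    (transDFA M A).eval x = (!x.isEmpty, fun s => M.evalFrom s x) := by
  induction x using List.reverseRecOn with
  | nil => rfl
  | append_singleton x a ih =>
    rw [DFA.eval_append_singleton, ih]
    simp [transDFA, DFA.evalFrom_append_singleton]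

theorem transDFA_regular {α : Type*} {σ : Type} [Finite σ] (M : DFA α σ)
    (A : Set (Bool × (σ → σ))) : (transDFA M A).accepts.IsRegular := by
  classical
  have := Fintype.ofFinite σ
  exact ⟨_, inferInstance, _, rfl⟩

theorem mem_transDFA {α σ : Type*} (M : DFA α σ) (A : Set (Bool × (σ → σ))) (x : List α) :
    x ∈ (transDFA M A).accepts ↔ (!x.isEmpty, fun s => M.evalFrom s x) ∈ A := by
  rw [DFA.mem_accepts, transDFA_eval]; rfl

/-- If every word of a regular language L is bordered, then L is a finite union of
languages J·K·J with J, K regular and ε ∉ J. -/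
theorem regular_all_bordered_decomposition {α : Type*} (L : Language α)
    (hreg : L.IsRegular) (hbord : ∀ w ∈ L, Bordered w) :
    ∃ (m : ℕ) (J K : Fin m → Language α),
      (∀ i, (J i).IsRegular ∧ (K i).IsRegular ∧ [] ∉ J i) ∧
      ∀ y, y ∈ L ↔ ∃ i : Fin m, y ∈ J i * K i * J i := by
  classical
  obtain ⟨σ, _, M, rfl⟩ := hreg
  let S := {p : (σ → σ) × (σ → σ) // p.1 (p.2 (p.1 M.start)) ∈ M.accept}
  obtain ⟨m, ⟨e⟩⟩ := Finite.exists_equiv_fin S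
  refine ⟨m, fun i => (transDFA M {q | q.1 = true ∧ q.2 = (e.symm i).1.1}).accepts,
    fun i => (transDFA M {q | q.2 = (e.symm i).1.2}).accepts, fun i =>
      ⟨transDFA_regular _ _, transDFA_regular _ _, ?_⟩, fun y => ⟨fun hy => ?_, ?_⟩⟩
  · rw [mem_transDFA]; simp
  · obtain ⟨u, w, hu, rfl⟩ := hbord y hy
    have hS : M.evalFrom (M.evalFrom (M.evalFrom M.start u) w) u ∈ M.accept := by
      rw [DFA.mem_accepts, DFA.eval, DFA.evalFrom_of_append, DFA.evalFrom_of_append] at hy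
      exact hy
    refine ⟨e ⟨(fun s => M.evalFrom s u, fun s => M.evalFrom s w), hS⟩, ?_⟩
    refine Language.append_mem_mul (Language.append_mem_mul ?_ ?_) ?_ <;>
      rw [mem_transDFA] <;> simp [hu]
  · rintro ⟨i, hi⟩
    obtain ⟨_, ⟨u, hu, w, hw, rfl⟩, v, hv, rfl⟩ := hi
    have hu := ((mem_transDFA _ _ _).1 hu).2
    have hv := ((mem_transDFA _ _ _).1 hv).2
    have hw := (mem_transDFA _ _ _).1 hw
    have h := (e.symm i).2
    simp only [Set.mem_ofPred_eq] at hu hv hw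
    have hu' := congrFun hu M.start
    have hw' := congrFun hw (M.evalFrom M.start u)
    have hv' := congrFun hv (M.evalFrom (M.evalFrom M.start u) w)
    change (u ++ w) ++ v ∈ M.accepts
    rw [DFA.mem_accepts, DFA.eval, DFA.evalFrom_of_append, DFA.evalFrom_of_append]
    rw [hv', hw', hu']
    exact h
end

section
/- Let M be an NFA with n states, let L be the language accepted by M, and let N be a non-negative integer. If every word in L whose length lies in the interval [N, 2N + 6n + 1] is bordered, then every word in L of length greater than 2N + 6n + 1 is bordered. In particular, if every word in L of length at most 6n + 1 is bordered, then every word in L is bordered. -/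
/-- Combinatorial core: the two mismatch positions and one further deletion are incompatible. -/
theorem border_core {β : Type*} (f : ℕ → β) (W n k a l b r i d c : ℕ)
    (hW : 6 * n + 2 ≤ W) (hk1 : 2 * k < W) (hk2 : W ≤ 2 * k + 2 * n + 1)
    (ha : 2 * a < W) (hb : 2 * b < W) (hc : 2 * c < W) (hab : b ≤ a)
    (hl : k ≤ l) (hla : l < a) (hr : r + W ≤ b + k + n) (hrb : r < b)
    (x1 : ∀ t < l, f t = f (W - a + t)) (x2 : f l ≠ f (W - a + l))
    (v1 : ∀ t, r < t → t < b → f t = f (W - b + t)) (v2 : f r ≠ f (W - b + r))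
    (hi : n ≤ i) (hd0 : 0 < d) (hd : i + d ≤ 2 * n) (hci : i < c)
    (u1 : ∀ t < i, f t = f (W - c + t))
    (u2 : ∀ t, i ≤ t → t < c → f (t + d) = f (W - c + t)) : False := by
  obtain ⟨p, rfl⟩ : ∃ p, a = b + p := ⟨a - b, by omega⟩
  by_cases hca : c < b + p
  · obtain ⟨s, hs⟩ : ∃ s, b + p = c + s := ⟨b + p - c, by omega⟩
    have e1 : f r = f (W - c + r) := u1 r (by omega)
    have e2 : f (r + p) = f (W - c + (r + p)) := u1 _ (by omega)
    have e3 : f (r + s) = f (W - (b + p) + (r + s)) := x1 _ (by omega)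
    have e4 : f (r + s) = f (W - b + (r + s)) := v1 _ (by omega) (by omega)
    have e5 : f (r + p) = f (W - (b + p) + (r + p)) := x1 _ (by omega)
    rw [show W - (b + p) + (r + s) = W - c + r by omega] at e3
    rw [show W - b + (r + s) = W - c + (r + p) by omega] at e4
    rw [show W - (b + p) + (r + p) = W - b + r by omega] at e5
    exact v2 (by rw [e1, ← e3, e4, ← e2, e5])
  · obtain ⟨q, rfl⟩ : ∃ q, c = b + q := ⟨c - b, by omega⟩
    have hrq : r + q + 1 ≤ n := by omega
    have hlr : 2 * n + r + p + 1 ≤ l := by omega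
    have hpq : p ≤ q := by omega
    have e1 : f (l - d + d) = f (W - (b + q) + (l - d)) := u2 _ (by omega) (by omega)
    have e2 : f (l - d - q) = f (W - b + (l - d - q)) := v1 _ (by omega) (by omega)
    have e3 : f (l - d - p + d) = f (W - (b + q) + (l - d - p)) := u2 _ (by omega) (by omega)
    have e4 : f (l - d - p - q) = f (W - b + (l - d - p - q)) := v1 _ (by omega) (by omega)
    have e5 : f (l - d - q) = f (W - (b + p) + (l - d - q)) := x1 _ (by omega)
    have e6 : f (l - d - p - q) = f (W - b + (l - d - p - q)) := v1 _ (by omega) (by omega)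
    have e7 : f (l - p) = f (W - b + (l - p)) := v1 _ (by omega) (by omega)
    rw [show l - d + d = l by omega,
      show W - (b + q) + (l - d) = W - b + (l - d - q) by omega] at e1
    rw [show l - d - p + d = l - p by omega,
      show W - (b + q) + (l - d - p) = W - b + (l - d - p - q) by omega] at e3
    rw [show W - (b + p) + (l - d - q) = W - b + (l - d - p - q) by omega] at e5
    rw [show W - b + (l - p) = W - (b + p) + l by omega] at e7
    exact x2 (by rw [e1, ← e2, e5, ← e3, e7])

/-- Deleting a segment centred in the left half and getting a border. -/
def LeftWit {β : Type*} (f : ℕ → β) (W i j c : ℕ) : Prop :=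
  i < c ∧ 2 * c < W ∧ (∀ t < i, f t = f (W - c + t)) ∧
    ∀ t, i ≤ t → t < c → f (t + (j - i)) = f (W - c + t)

/-- The abstract statement about unbordered sequences and the set of their deletable segments. -/
theorem no_minimal {β : Type*} (f : ℕ → β) (W n : ℕ) (P : ℕ → ℕ → Prop)
    (hW : 6 * n + 2 ≤ W)
    (hP : ∀ k, k + n ≤ W → ∃ i j, k ≤ i ∧ i < j ∧ j ≤ k + n ∧ P i j)
    (hunb : ∀ c, 1 ≤ c → 2 * c ≤ W → ∃ t < c, f t ≠ f (W - c + t))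
    (hdel : ∀ i j, i < j → j ≤ W → P i j → ∃ c, 1 ≤ c ∧ 2 * c ≤ W - (j - i) ∧
      ∀ t < c, (if t < i then f t else f (t + (j - i))) =
        (if W - (j - i) - c + t < i then f (W - (j - i) - c + t)
          else f (W - (j - i) - c + t + (j - i)))) : False := by
  classical
  -- left deletions
  have hL : ∀ i j, i < j → i + j ≤ W → P i j → ∃ c, LeftWit f W i j c := by
    intro i j hij hs hp
    obtain ⟨c, hc1, hc2, hc⟩ := hdel i j hij (by omega) hp
    have hc' : ∀ t < c, (if t < i then f t else f (t + (j - i))) = f (W - c + t) := by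
      intro t ht
      have h := hc t ht
      rw [if_neg (show ¬ (W - (j - i) - c + t < i) by omega),
        show W - (j - i) - c + t + (j - i) = W - c + t by omega] at h
      exact h
    refine ⟨c, ?_, by omega, ?_, ?_⟩
    · by_contra hcon
      obtain ⟨t, ht, hne⟩ := hunb c hc1 (by omega)
      have h := hc' t ht
      rw [if_pos (by omega)] at h
      exact hne h
    · by_contra hcon
      push Not at hcon
      obtain ⟨t, ht, hne⟩ := hcon
      by_cases htc : t < c
      · have h := hc' t htc
        rw [if_pos ht] at h
        exact hne h
      · obtain ⟨t, ht, hne⟩ := hunb c hc1 (by omega)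
        have h := hc' t ht
        rw [if_pos (by omega)] at h
        exact hne h
    · intro t ht htc
      have h := hc' t htc
      rw [if_neg (by omega)] at h
      exact h
  -- right deletions
  have hR : ∀ i j, i < j → j ≤ W → W ≤ i + j → P i j →
      ∃ c, LeftWit (fun t => f (W - 1 - t)) W (W - j) (W - i) c := by
    intro i j hij hjW hs hp
    obtain ⟨c, hc1, hc2, hc⟩ := hdel i j hij (by omega) hp
    have hc' : ∀ t < c, f t =
        (if W - (j - i) - c + t < i then f (W - (j - i) - c + t) else f (W - c + t)) := by
      intro t ht
      have h := hc t ht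
      rw [if_pos (show t < i by omega),
        show W - (j - i) - c + t + (j - i) = W - c + t by omega] at h
      exact h
    have hlt : W - j < c := by
      by_contra hcon
      obtain ⟨t, ht, hne⟩ := hunb c hc1 (by omega)
      have h := hc' t ht
      rw [if_neg (by omega)] at h
      exact hne h
    refine ⟨c, hlt, by omega, ?_, ?_⟩
    · intro t ht
      have h := hc' (c - 1 - t) (by omega)
      rw [if_neg (by omega)] at h
      show f (W - 1 - t) = f (W - 1 - (W - c + t))
      rw [show W - 1 - t = W - c + (c - 1 - t) by omega,
        show W - 1 - (W - c + t) = c - 1 - t by omega]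
      exact h.symm
    · intro t ht htc
      have h := hc' (c - 1 - t) (by omega)
      rw [if_pos (by omega)] at h
      show f (W - 1 - (t + (W - i - (W - j)))) = f (W - 1 - (W - c + t))
      rw [show W - 1 - (t + (W - i - (W - j))) = W - (j - i) - c + (c - 1 - t) by omega,
        show W - 1 - (W - c + t) = c - 1 - t by omega]
      exact h.symm
  -- the window where the type changes
  obtain ⟨k, ⟨i, j, hki, hij, hjk, hs, hp⟩, hk⟩ : ∃ k,
      (∃ i j, k ≤ i ∧ i < j ∧ j ≤ k + n ∧ i + j ≤ W ∧ P i j) ∧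
      ¬ (∃ i j, k + 1 ≤ i ∧ i < j ∧ j ≤ k + 1 + n ∧ i + j ≤ W ∧ P i j) := by
    by_contra hcon
    push Not at hcon
    have hall : ∀ k, ∃ i j, k ≤ i ∧ i < j ∧ j ≤ k + n ∧ i + j ≤ W ∧ P i j := by
      intro k
      induction k with
      | zero =>
        obtain ⟨i, j, h1, h2, h3, h4⟩ := hP 0 (by omega)
        exact ⟨i, j, h1, h2, h3, by omega, h4⟩
      | succ k ih => exact hcon k ih
    obtain ⟨i, j, h1, h2, h3, h4, h5⟩ := hall W
    omega
  obtain ⟨i', j', hki', hij', hjk', hp'⟩ := hP (k + 1) (by omega)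
  have hs' : W < i' + j' := by
    by_contra hcon
    exact hk ⟨i', j', hki', hij', hjk', by omega, hp'⟩
  obtain ⟨a, ha1, ha2, ha3, -⟩ := hL i j hij hs hp
  obtain ⟨b, hb1, hb2, hb3, -⟩ := hR i' j' hij' (by omega) hs'.le hp'
  have hexA : ∃ t, t < a ∧ f t ≠ f (W - a + t) := hunb a (by omega) (by omega)
  obtain ⟨l, ⟨hla, hlne⟩, hlmin⟩ : ∃ l, (l < a ∧ f l ≠ f (W - a + l)) ∧
      ∀ t < l, f t = f (W - a + t) := by
    refine ⟨Nat.find hexA, Nat.find_spec hexA, fun t ht => ?_⟩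
    by_contra hne
    exact Nat.find_min hexA ht ⟨by have := (Nat.find_spec hexA).1; omega, hne⟩
  -- first mismatch from the right, in reversed coordinates
  have hexB : ∃ t, t < b ∧ f (W - 1 - t) ≠ f (W - 1 - (W - b + t)) := by
    obtain ⟨t, ht, hne⟩ := hunb b (by omega) (by omega)
    refine ⟨b - 1 - t, by omega, ?_⟩
    rw [show W - 1 - (b - 1 - t) = W - b + t by omega,
      show W - 1 - (W - b + (b - 1 - t)) = t by omega]
    exact hne.symm
  obtain ⟨m, ⟨hmb, hmne⟩, hmmin⟩ : ∃ m, (m < b ∧ f (W - 1 - m) ≠ f (W - 1 - (W - b + m))) ∧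
      ∀ t < m, f (W - 1 - t) = f (W - 1 - (W - b + t)) := by
    refine ⟨Nat.find hexB, Nat.find_spec hexB, fun t ht => ?_⟩
    by_contra hne
    exact Nat.find_min hexB ht ⟨by have := (Nat.find_spec hexB).1; omega, hne⟩
  have hil : i ≤ l := by
    by_contra hcon
    exact hlne (ha3 l (by omega))
  have hjm : W - j' ≤ m := by
    by_contra hcon
    exact hmne (hb3 m (by omega))
  rcases le_total b a with hab | hab
  · obtain ⟨i₁, j₁, h1, h2, h3, h4⟩ := hP n (by omega)
    obtain ⟨c, hc1, hc2, hc3, hc4⟩ := hL i₁ j₁ h2 (by omega) h4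
    refine border_core f W n k a l b (b - 1 - m) i₁ (j₁ - i₁) c hW (by omega) (by omega)
      ha2 hb2 hc2 hab (by omega) hla (by omega) (by omega) hlmin hlne ?_ ?_ h1 (by omega) (by omega)
      hc1 hc3 hc4
    · intro t ht htb
      have h := hmmin (b - 1 - t) (by omega)
      rw [show W - 1 - (b - 1 - t) = W - b + t by omega,
        show W - 1 - (W - b + (b - 1 - t)) = t by omega] at h
      exact h.symm
    · rw [show W - 1 - m = W - b + (b - 1 - m) by omega,
        show W - 1 - (W - b + m) = b - 1 - m by omega] at hmne
      exact hmne.symm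
  · obtain ⟨i₁, j₁, h1, h2, h3, h4⟩ := hP (W - 2 * n) (by omega)
    obtain ⟨c, hc1, hc2, hc3, hc4⟩ := hR i₁ j₁ h2 (by omega) (by omega) h4
    refine border_core (fun t => f (W - 1 - t)) W n (W - k - n - 1) b m a (a - 1 - l)
      (W - j₁) (W - i₁ - (W - j₁)) c hW (by omega) (by omega)
      hb2 ha2 hc2 hab (by omega) hmb (by omega) (by omega) hmmin hmne ?_ ?_ (by omega)
      (by omega) (by omega)
      hc1 hc3 hc4
    · intro t ht htb
      have h := hlmin (a - 1 - t) (by omega)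
      show f (W - 1 - t) = f (W - 1 - (W - a + t))
      rw [show W - 1 - t = W - a + (a - 1 - t) by omega,
        show W - 1 - (W - a + (t)) = a - 1 - t by omega]
      exact h.symm
    · show f (W - 1 - (a - 1 - l)) ≠ f (W - 1 - (W - a + (a - 1 - l)))
      rw [show W - 1 - (a - 1 - l) = W - a + l by omega,
        show W - 1 - (W - a + (a - 1 - l)) = l by omega]
      exact hlne.symm

theorem bordered_iff_index {α : Type*} (x : List α) :
    Bordered x ↔ ∃ c, 1 ≤ c ∧ 2 * c ≤ x.length ∧ ∀ t < c, x[t]? = x[x.length - c + t]? := by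
  constructor
  · rintro ⟨u, v, hu, rfl⟩
    have hpos := List.length_pos_iff.mpr hu
    refine ⟨u.length, hpos, by simp; omega, fun t ht => ?_⟩
    have hlen : (u ++ v ++ u).length - u.length + t = (u ++ v).length + t := by simp; omega
    have h1 : (u ++ v ++ u)[(u ++ v).length + t]? = u[t]? := by
      rw [List.getElem?_append_right (by omega), Nat.add_sub_cancel_left]
    have h2 : (u ++ v ++ u)[t]? = u[t]? := by
      rw [List.append_assoc, List.getElem?_append_left ht]
    rw [hlen, h1, h2]
  · rintro ⟨c, hc1, hc2, hc⟩
    refine ⟨x.take c, (x.drop c).take (x.length - 2 * c), ?_, ?_⟩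
    · intro h
      have h' : (x.take c).length = 0 := by rw [h]; rfl
      rw [List.length_take] at h'
      omega
    · have hsuf : x.take c = x.drop (x.length - c) := by
        apply List.ext_getElem?
        intro t
        rw [List.getElem?_take, List.getElem?_drop]
        split_ifs with h
        · exact hc t h
        · symm
          rw [List.getElem?_eq_none_iff]
          omega
      have h2 : x.drop c = (x.drop c).take (x.length - 2 * c) ++ x.drop (x.length - c) := by
        conv_lhs => rw [← List.take_append_drop (x.length - 2 * c) (x.drop c)]
        rw [List.drop_drop]
        congr 2
        omega
      rw [List.append_assoc]
      conv_lhs => rw [← List.take_append_drop c x, h2]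
      rw [← hsuf]

theorem bordered_step {α σ : Type*} [Fintype σ] (M : NFA α σ) (w : List α)
    (hw : w ∈ M.accepts) (hlen : 6 * Fintype.card σ + 2 ≤ w.length)
    (hmin : ∀ v ∈ M.accepts, v.length < w.length → w.length ≤ v.length + Fintype.card σ →
      Bordered v) : Bordered w := by
  by_contra hunb
  rw [NFA.mem_accepts] at hw
  obtain ⟨s, hs, hsw⟩ := hw
  have hq : ∀ t, ∃ q : σ, q ∈ M.evalFrom M.start (w.take t) ∧ s ∈ M.evalFrom {q} (w.drop t) := by
    intro t
    rw [← List.take_append_drop t w, NFA.evalFrom_append, NFA.mem_evalFrom_iff_exists] at hsw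
    exact hsw
  choose q hq1 hq2 using hq
  refine no_minimal (fun t => w[t]?) w.length (Fintype.card σ)
    (fun i j => q i = q j ∧ j ≤ i + Fintype.card σ) hlen ?_ ?_ ?_
  · intro k hk
    obtain ⟨x, y, hne, hxy⟩ := Fintype.exists_ne_map_eq_of_card_lt
      (fun x : Fin (Fintype.card σ + 1) => q (k + x)) (by simp)
    have hne' : x.1 ≠ y.1 := fun h => hne (Fin.ext h)
    have := x.2
    have := y.2
    rcases Nat.lt_or_gt_of_ne hne' with h | h
    · exact ⟨k + x, k + y, by omega, by omega, by omega, hxy, by omega⟩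
    · exact ⟨k + y, k + x, by omega, by omega, by omega, hxy.symm, by omega⟩
  · intro c hc1 hc2
    by_contra hcon
    push Not at hcon
    exact hunb ((bordered_iff_index w).2 ⟨c, hc1, hc2, hcon⟩)
  · rintro i j hij hjW ⟨hqij, hji⟩
    have hl : (w.take i ++ w.drop j).length = w.length - (j - i) := by
      simp
      omega
    have hacc : w.take i ++ w.drop j ∈ M.accepts := by
      rw [NFA.mem_accepts]
      refine ⟨s, hs, ?_⟩
      rw [NFA.evalFrom_append, NFA.mem_evalFrom_iff_exists]
      exact ⟨q i, hq1 i, hqij ▸ hq2 j⟩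
    have hget : ∀ t, (w.take i ++ w.drop j)[t]? =
        if t < i then w[t]? else w[t + (j - i)]? := by
      intro t
      have hti : (w.take i).length = i := by simp; omega
      split_ifs with h
      · rw [List.getElem?_append_left (by omega), List.getElem?_take, if_pos h]
      · rw [List.getElem?_append_right (by omega), List.getElem?_drop, hti]
        congr 1
        omega
    obtain ⟨c, hc1, hc2, hc⟩ := (bordered_iff_index _).1
      (hmin _ hacc (by omega) (by omega))
    rw [hl] at hc2 hc
    refine ⟨c, hc1, hc2, fun t ht => ?_⟩
    have h := hc t ht
    rw [hget, hget] at h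
    exact h

/-- If every word accepted by an n-state NFA with length in [N, 2N + 6n + 1] is bordered,
then every accepted word of length > 2N + 6n + 1 is bordered.  In particular, if every
accepted word of length ≤ 6n + 1 is bordered, then every accepted word is bordered. -/
theorem nfa_bordered_threshold {α σ : Type*} [Fintype σ] (M : NFA α σ) (n : ℕ)
    (hn : Fintype.card σ = n) (N : ℕ) :
    ((∀ w ∈ M.accepts, N ≤ w.length → w.length ≤ 2 * N + 6 * n + 1 → Bordered w) →
      ∀ w ∈ M.accepts, 2 * N + 6 * n + 1 < w.length → Bordered w) ∧
    ((∀ w ∈ M.accepts, w.length ≤ 6 * n + 1 → Bordered w) →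
      ∀ w ∈ M.accepts, Bordered w) := by
  subst hn
  have main : ∀ N : ℕ, (∀ w ∈ M.accepts, N ≤ w.length →
      w.length ≤ 2 * N + 6 * Fintype.card σ + 1 → Bordered w) →
      ∀ L : ℕ, ∀ w ∈ M.accepts, w.length = L → N ≤ w.length → Bordered w := by
    intro N h L
    induction L using Nat.strong_induction_on with
    | _ L ih =>
      intro w hw hL hN
      by_cases hle : w.length ≤ 2 * N + 6 * Fintype.card σ + 1
      · exact h w hw hN hle
      · refine bordered_step M w hw (by omega) fun v hv h1 h2 => ?_
        exact ih v.length (by omega) v hv rfl (by omega)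
  refine ⟨fun h w hw hl => main N h _ w hw rfl (by omega), fun h w hw => ?_⟩
  exact main 0 (fun w hw _ h2 => h w hw (by omega)) _ w hw rfl (Nat.zero_le _)
end

section
/- Suppose Ψ_L, Ψ_R, e, f, g, h are words with |Ψ_L| = |Ψ_R|, |e| < |Ψ_L|, |g| < |Ψ_L|, satisfying Ψ_L·e = f·Ψ_R and Ψ_L·g = h·Ψ_R, and suppose |Ψ_L·g| < |Ψ_L·e|. Then there exist a non-empty word p, a word q with |g| + |p·q| = |f|, and a positive integer k such that Ψ_L = h·(p·q)ᵏ·p and Ψ_R = (p·q)ᵏ·p·g. -/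
theorem aux_period {α : Type*} (r : List α) (hr : r ≠ []) : ∀ (n : ℕ) (w : List α),
    w.length ≤ n → w ≠ [] → w <+: r ++ w →
    ∃ (p q : List α) (k : ℕ), p ≠ [] ∧ r = p ++ q ∧ w = listPow r k ++ p := by
  intro n
  induction n with
  | zero =>
    intro w hw hne
    exact absurd (List.length_eq_zero_iff.mp (by omega)) hne
  | succ n ih =>
    intro w hw hne hp
    by_cases hl : w.length ≤ r.length
    · obtain ⟨q, hq⟩ := List.prefix_of_prefix_length_le hp (List.prefix_append r w) hl
      exact ⟨w, q, 0, hne, hq.symm, by simp [listPow]⟩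
    · obtain ⟨w', rfl⟩ := List.prefix_of_prefix_length_le (List.prefix_append r w) hp (by omega)
      have hrl := List.length_pos_iff.mpr hr
      simp only [List.length_append] at hl hw
      have hp' : w' <+: r ++ w' := (List.prefix_append_right_inj r).mp hp
      obtain ⟨p, q, k, h1, h2, h3⟩ := ih w' (by omega)
        (by rintro rfl; simp at hl) hp'
      refine ⟨p, q, k + 1, h1, h2, ?_⟩
      conv_lhs => rw [h3]
      simp [listPow, List.replicate_succ]

/-- If Ψ_L·e = f·Ψ_R and Ψ_L·g = h·Ψ_R with |Ψ_L| = |Ψ_R|, |e| < |Ψ_L|, |g| < |Ψ_L|,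
and |Ψ_L·g| < |Ψ_L·e|, then Ψ_L = h·(pq)ᵏ·p and Ψ_R = (pq)ᵏ·p·g for some non-empty p,
some q with |g| + |pq| = |f|, and some positive integer k. -/
theorem border_overlap_lemma {α : Type*} (ΨL ΨR e f g h : List α)
    (hlen : ΨL.length = ΨR.length)
    (he : e.length < ΨL.length) (hg : g.length < ΨL.length)
    (h1 : ΨL ++ e = f ++ ΨR) (h2 : ΨL ++ g = h ++ ΨR)
    (hlt : (ΨL ++ g).length < (ΨL ++ e).length) :
    ∃ (p q : List α) (k : ℕ), p ≠ [] ∧ g.length + (p ++ q).length = f.length ∧ 1 ≤ k ∧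
      ΨL = h ++ listPow (p ++ q) k ++ p ∧ ΨR = listPow (p ++ q) k ++ p ++ g := by
  have l1 := congrArg List.length h1
  have l2 := congrArg List.length h2
  simp only [List.length_append] at l1 l2 hlt
  have hf : f <+: ΨL := List.prefix_of_prefix_length_le (l₃ := ΨL ++ e)
    (h1 ▸ List.prefix_append f ΨR) (List.prefix_append _ _) (by omega)
  have hh : h <+: f := List.prefix_of_prefix_length_le (l₃ := ΨL)
    (List.prefix_of_prefix_length_le (l₃ := ΨL ++ g)
      (h2 ▸ List.prefix_append h ΨR) (List.prefix_append _ _) (by omega)) hf (by omega)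
  obtain ⟨r, rfl⟩ := hh
  obtain ⟨w, rfl⟩ := hf
  simp only [List.append_assoc, List.append_cancel_left_eq, List.length_append] at *
  have hw : w <+: r ++ w := List.prefix_of_prefix_length_le (l₃ := ΨR)
    ⟨e, h1⟩ ⟨g, by simpa using h2⟩ (by simp)
  obtain ⟨p, q, k, a, b, c⟩ := aux_period r
    (by rintro rfl; simp at *; omega) _ w le_rfl (by rintro rfl; simp at *; omega) hw
  have hv : r ++ w = listPow (p ++ q) (k + 1) ++ p := by
    rw [← b]
    conv_lhs => rw [c]
    simp [listPow, List.replicate_succ]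
  have hb := congrArg List.length b
  simp only [List.length_append] at hb
  refine ⟨p, q, k + 1, a, by omega, by omega, by rw [hv], ?_⟩
  rw [← h2, ← List.append_assoc, hv, List.append_assoc]
end
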